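/- arXiv:1605.07283 — 3 statements merged into one kernel-verified Lean document; each statement's English description precedes it below -/
import Mathlib

section
/- Let β > 1 and let Σ_β be the β-shift, with shift map σ and the metric d(u,v) = e^{-|u∧v|}. Let f : Σ_β → (0,∞) be a continuous positive function. Then the Hausdorff dimension of R(f) = {x ∈ Σ_β : d(σ^n x, x) ≤ e^{-S_n f(x)} for infinitely many n} is the unique solution s ≥ 0 of the pressure equation P(−s(f+1)) = 0. -/
open Filter MeasureTheory Set
open scoped ENNReal NNReal

noncomputable section

def SeqSpace (A : Type*) : Type _ := ℕ → A

namespace SeqSpace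

variable {A : Type*}

/-- `|u ∧ v|`: the length of the longest common prefix of `u` and `v`. -/
def lcp (u v : SeqSpace A) : ℕ := sInf {n | u n ≠ v n}

theorem lcp_mem {u v : SeqSpace A} (h : u ≠ v) : u (lcp u v) ≠ v (lcp u v) := by
  have hne : {n | u n ≠ v n}.Nonempty := by
    rcases Function.ne_iff.mp h with ⟨n, hn⟩
    exact ⟨n, hn⟩
  exact Nat.sInf_mem hne

theorem min_lcp_le (u v w : SeqSpace A) (huw : u ≠ w) :
    min (lcp u v) (lcp v w) ≤ lcp u w := by
  by_cases h : u (lcp u w) = v (lcp u w)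
  · have hvw : v (lcp u w) ≠ w (lcp u w) := h ▸ lcp_mem huw
    exact le_trans (min_le_right _ _) (Nat.sInf_le hvw)
  · exact le_trans (min_le_left _ _) (Nat.sInf_le h)

open scoped Classical in
/-- The metric `d(u,v) = e^{-|u ∧ v|}`. -/
def sdist (u v : SeqSpace A) : ℝ :=
  if u = v then 0 else Real.exp (-(lcp u v : ℝ))

theorem sdist_nonneg' (u v : SeqSpace A) : 0 ≤ sdist u v := by
  unfold sdist
  split
  · exact le_refl 0
  · exact (Real.exp_pos _).le

theorem lcp_comm (u v : SeqSpace A) : lcp u v = lcp v u := by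
  unfold lcp
  congr 1
  ext n
  exact ne_comm

theorem sdist_self' (u : SeqSpace A) : sdist u u = 0 := by simp [sdist]

theorem sdist_comm' (u v : SeqSpace A) : sdist u v = sdist v u := by
  unfold sdist
  by_cases h : u = v
  · simp [h]
  · rw [if_neg h, if_neg (Ne.symm h), lcp_comm]

theorem sdist_triangle' (u v w : SeqSpace A) : sdist u w ≤ sdist u v + sdist v w := by
  by_cases huw : u = w
  · rw [show sdist u w = 0 by rw [huw]; exact sdist_self' w]
    exact add_nonneg (sdist_nonneg' _ _) (sdist_nonneg' _ _)
  by_cases huv : u = v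
  · subst huv
    rw [sdist_self', zero_add]
  by_cases hvw : v = w
  · subst hvw
    rw [sdist_self', add_zero]
  simp only [sdist, if_neg huw, if_neg huv, if_neg hvw]
  have h1 : min (lcp u v) (lcp v w) ≤ lcp u w := min_lcp_le u v w huw
  rcases le_total (lcp u v) (lcp v w) with hle | hle
  · have h2 : lcp u v ≤ lcp u w := by rw [min_eq_left hle] at h1; exact h1
    have h3 : Real.exp (-(lcp u w : ℝ)) ≤ Real.exp (-(lcp u v : ℝ)) :=
      Real.exp_le_exp.mpr (by exact_mod_cast neg_le_neg (Nat.cast_le.mpr h2))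
    linarith [Real.exp_pos (-(lcp v w : ℝ))]
  · have h2 : lcp v w ≤ lcp u w := by rw [min_eq_right hle] at h1; exact h1
    have h3 : Real.exp (-(lcp u w : ℝ)) ≤ Real.exp (-(lcp v w : ℝ)) :=
      Real.exp_le_exp.mpr (by exact_mod_cast neg_le_neg (Nat.cast_le.mpr h2))
    linarith [Real.exp_pos (-(lcp u v : ℝ))]

theorem sdist_eq_zero' {u v : SeqSpace A} (h : sdist u v = 0) : u = v := by
  by_contra hne
  rw [sdist, if_neg hne] at h
  exact (Real.exp_pos _).ne' h

instance : MetricSpace (SeqSpace A) where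
  dist := sdist
  dist_self := sdist_self'
  dist_comm := sdist_comm'
  dist_triangle := sdist_triangle'
  eq_of_dist_eq_zero := sdist_eq_zero'

end SeqSpace

namespace SeqSpace

variable {A : Type*}

/-- The left shift map `σ`. -/
def shift (x : SeqSpace A) : SeqSpace A := fun n => x (n + 1)

/-- The word `w` occurs in `x` starting at position `k`. -/
def OccursAt (w : List A) (x : SeqSpace A) (k : ℕ) : Prop :=
  ∀ i, (h : i < w.length) → x (k + i) = w[i]'h

/-- The language of `X`: all finite words appearing in some point of `X`. -/
def language (X : Set (SeqSpace A)) : Set (List A) :=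
  {w | ∃ x ∈ X, ∃ k, OccursAt w x k}

/-- The cylinder `[w]` of a finite word `w`. -/
def cyl (w : List A) : Set (SeqSpace A) := {x | OccursAt w x 0}

/-- Birkhoff sum `S_n φ = ∑_{k=0}^{n-1} φ ∘ σ^k`. -/
def birkhoff (φ : SeqSpace A → ℝ) (n : ℕ) (x : SeqSpace A) : ℝ :=
  ∑ k ∈ Finset.range n, φ (shift^[k] x)

/-- The words of length `n` in a collection `D` of words. -/
def wordsOfLen (D : Set (List A)) (n : ℕ) : Set (List A) := {w ∈ D | w.length = n}

/-- Topological pressure `P(D,φ)` of a potential `φ` computed over the words of `D`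
(the points of the subshift `X` are used to evaluate the Birkhoff sups over cylinders). -/
def pressure (X : Set (SeqSpace A)) (D : Set (List A)) (φ : SeqSpace A → ℝ) : ℝ :=
  atTop.limsup fun n =>
    Real.log (∑ᶠ w ∈ wordsOfLen D n, Real.exp (sSup (birkhoff φ n '' (X ∩ cyl w)))) / n

/-- The recurrence set `R(ψ)` of points of `X` with `d(σ^n x, x) < ψ(n)` infinitely often. -/
def recSet (X : Set (SeqSpace A)) (ψ : ℕ → ℝ) : Set (SeqSpace A) :=
  {x ∈ X | ∃ᶠ n in atTop, dist (shift^[n] x) x < ψ n}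

/-- The recurrence set `R(f)` of points of `X` with `d(σ^n x, x) ≤ e^{-S_n f(x)}`
infinitely often. -/
def recSetF (X : Set (SeqSpace A)) (f : SeqSpace A → ℝ) : Set (SeqSpace A) :=
  {x ∈ X | ∃ᶠ n in atTop, dist (shift^[n] x) x ≤ Real.exp (-(birkhoff f n x))}

/-- A single edit of a word: substitution, insertion or deletion of one symbol. -/
def EditStep (w w' : List A) : Prop :=
  (∃ (u₁ u₂ : List A) (a a' : A), w = u₁ ++ a :: u₂ ∧ w' = u₁ ++ a' :: u₂) ∨
  (∃ (u₁ u₂ : List A) (a' : A), w = u₁ ++ u₂ ∧ w' = u₁ ++ a' :: u₂) ∨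
  (∃ (u₁ u₂ : List A) (a : A), w = u₁ ++ a :: u₂ ∧ w' = u₁ ++ u₂)

/-- `EditChain n v w` : `v` can be transformed into `w` by `n` edits. -/
def EditChain : ℕ → List A → List A → Prop
  | 0, v, w => v = w
  | n + 1, v, w => ∃ u, EditStep v u ∧ EditChain n u w

/-- The edit distance `d̂(v,w)`: the minimal number of edits transforming `v` into `w`. -/
def editDist (v w : List A) : ℕ := sInf {n | EditChain n v w}

/-- A mistake function: a nondecreasing `g : ℕ → ℕ` with `g n / n → 0`. -/
def MistakeFunction (g : ℕ → ℕ) : Prop :=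
  Monotone g ∧ Tendsto (fun n => (g n : ℝ) / n) atTop (nhds 0)

/-- `L` is edit approachable by `G`. -/
def EditApproachable (L G : Set (List A)) : Prop :=
  ∃ g : ℕ → ℕ, MistakeFunction g ∧ ∀ w ∈ L, ∃ v ∈ G, editDist v w ≤ g w.length

/-- `G ⊆ L` has (W)-specification with gap length `τ`. -/
def HasSpecW (L G : Set (List A)) (τ : ℕ) : Prop :=
  ∀ v ∈ G, ∀ w ∈ G, ∃ u ∈ L, u.length ≤ τ ∧ v ++ u ++ w ∈ G

/-- The (non-strict) lexicographic order on sequences. -/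
def LexLe [LinearOrder A] (u v : SeqSpace A) : Prop :=
  u = v ∨ ∃ n, (∀ i < n, u i = v i) ∧ u n < v n

end SeqSpace

open SeqSpace

/-- The β-shift determined by the greedy β-expansion `w` of `1`:
all sequences `x` with `σ^j x ≼ w` for all `j ≥ 1`. -/
def betaShift (β : ℝ) (w : SeqSpace (Fin ⌈β⌉₊)) : Set (SeqSpace (Fin ⌈β⌉₊)) :=
  {x | ∀ j : ℕ, 1 ≤ j → LexLe (shift^[j] x) w}

namespace BetaRec

section basics
variable {A : Type*}

theorem shift_iter (x : SeqSpace A) (k n : ℕ) : (shift^[k] x) n = x (k + n) := by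
  induction k generalizing n with
  | zero => simp
  | succ k ih =>
    rw [Function.iterate_succ_apply']
    show (shift^[k] x) (n + 1) = _
    rw [ih]
    congr 1
    omega

theorem dist_def (x y : SeqSpace A) : dist x y = sdist x y := rfl

theorem dist_le_of_agree (x y : SeqSpace A) (L : ℕ) (h : ∀ i < L, x i = y i) :
    dist x y ≤ Real.exp (-(L : ℝ)) := by
  rw [dist_def]
  by_cases hxy : x = y
  · rw [hxy, sdist_self']; exact (Real.exp_pos _).le
  · rw [sdist, if_neg hxy]
    apply Real.exp_le_exp.mpr
    have : L ≤ lcp x y := by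
      by_contra hlt
      push Not at hlt
      exact lcp_mem hxy (h _ hlt)
    have : (L : ℝ) ≤ lcp x y := by exact_mod_cast this
    linarith

theorem agree_of_dist_le (x y : SeqSpace A) (r : ℝ) (h : dist x y ≤ Real.exp (-r)) (i : ℕ)
    (hi : (i : ℝ) < r) : x i = y i := by
  rw [dist_def] at h
  by_cases hxy : x = y
  · rw [hxy]
  · rw [sdist, if_neg hxy, Real.exp_le_exp] at h
    have h2 : (i : ℝ) < lcp x y := by linarith
    have h3 : i < lcp x y := by exact_mod_cast h2
    have := Nat.notMem_of_lt_sInf h3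
    simpa using this

theorem birkhoff_add (φ : SeqSpace A → ℝ) (m n : ℕ) (x : SeqSpace A) :
    birkhoff φ (m + n) x = birkhoff φ m x + birkhoff φ n (shift^[m] x) := by
  unfold birkhoff
  rw [Finset.sum_range_add]
  congr 1
  apply Finset.sum_congr rfl
  intro k _
  rw [← Function.iterate_add_apply, add_comm k m]

theorem birkhoff_phi (f : SeqSpace A → ℝ) (s : ℝ) (n : ℕ) (x : SeqSpace A) :
    birkhoff (fun x => -(s * (f x + 1))) n x = -(s * (birkhoff f n x + n)) := by
  unfold birkhoff
  rw [Finset.sum_neg_distrib, ← Finset.mul_sum, Finset.sum_add_distrib]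
  simp

theorem cyl_iff (v : List A) (x : SeqSpace A) :
    x ∈ cyl v ↔ ∀ i, (h : i < v.length) → x i = v[i]'h := by
  unfold cyl OccursAt
  simp

end basics

section cpt
variable {b : ℕ}

instance : CompactSpace (SeqSpace (Fin b)) := by
  let g : (ℕ → Fin b) → SeqSpace (Fin b) := fun x => x
  have hg : Continuous g := by
    rw [continuous_iff_continuousAt]
    intro x
    rw [ContinuousAt, Metric.tendsto_nhds]
    intro ε hε
    obtain ⟨n, hn⟩ : ∃ n : ℕ, Real.exp (-(n : ℝ)) < ε := by
      have : Tendsto (fun n : ℕ => Real.exp (-(n : ℝ))) atTop (nhds 0) :=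
        Real.tendsto_exp_neg_atTop_nhds_zero.comp tendsto_natCast_atTop_atTop
      exact (this.eventually (gt_mem_nhds hε)).exists
    have : ∀ᶠ y in nhds x, ∀ i ∈ Finset.range n, y i = x i := by
      rw [Finset.eventually_all]
      intro i _
      have hc : ContinuousAt (fun y : ℕ → Fin b => y i) x := (continuous_apply i).continuousAt
      exact hc.eventually (show ∀ᶠ a in nhds (x i), a = x i by simp [nhds_discrete])
    filter_upwards [this] with y hy
    refine lt_of_le_of_lt (dist_le_of_agree _ _ n ?_) hn
    intro i hi
    exact hy i (Finset.mem_range.mpr hi)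
  have hr : range g = univ := by
    ext x; simp only [mem_range, mem_univ, iff_true]; exact ⟨x, rfl⟩
  constructor
  rw [← hr]
  exact isCompact_range hg

theorem lex_of_not {x w : SeqSpace (Fin b)} (h : ¬ LexLe x w) :
    ∃ n, (∀ i < n, x i = w i) ∧ w n < x n := by
  unfold LexLe at h
  push Not at h
  obtain ⟨h1, h2⟩ := h
  refine ⟨lcp x w, ?_, ?_⟩
  · intro i hi
    simpa using Nat.notMem_of_lt_sInf hi
  · have h3 := h2 (lcp x w) (fun i hi => by simpa using Nat.notMem_of_lt_sInf hi)
    exact lt_of_le_of_ne h3 (lcp_mem h1).symm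

theorem not_lex {x w : SeqSpace (Fin b)} {n : ℕ} (h : ∀ i < n, x i = w i) (h2 : w n < x n) :
    ¬ LexLe x w := by
  rintro (h3 | ⟨m, h3, h4⟩)
  · rw [h3] at h2; exact lt_irrefl _ h2
  · rcases lt_trichotomy m n with hl | hl | hl
    · rw [h m hl] at h4; exact lt_irrefl _ h4
    · subst hl; exact lt_asymm h2 h4
    · rw [h3 n hl] at h2; exact lt_irrefl _ h2

end cpt

section X
variable {β : ℝ} {w : SeqSpace (Fin ⌈β⌉₊)}

theorem mem_iff (x : SeqSpace (Fin ⌈β⌉₊)) :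
    x ∈ betaShift β w ↔ ∀ j : ℕ, 1 ≤ j → LexLe (shift^[j] x) w := Iff.rfl

theorem shift_mem {x : SeqSpace (Fin ⌈β⌉₊)} (hx : x ∈ betaShift β w) (k : ℕ) :
    shift^[k] x ∈ betaShift β w := by
  intro j hj
  rw [← Function.iterate_add_apply]
  exact hx _ (by omega)

theorem isClosed_X : IsClosed (betaShift β w) := by
  rw [← isOpen_compl_iff, Metric.isOpen_iff]
  intro x hx
  simp only [mem_compl_iff, mem_iff] at hx
  push Not at hx
  obtain ⟨j, hj, h⟩ := hx
  obtain ⟨n, h1, h2⟩ := lex_of_not h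
  refine ⟨Real.exp (-((j + n + 1 : ℕ) : ℝ)), Real.exp_pos _, ?_⟩
  intro y hy hyX
  have hag := agree_of_dist_le y x _ (Metric.mem_ball.mp hy).le
  have hag' : ∀ i ≤ n, (shift^[j] y) i = (shift^[j] x) i := by
    intro i hi
    rw [shift_iter, shift_iter]
    apply hag
    exact_mod_cast (by omega : j + i < j + n + 1)
  refine not_lex (n := n) ?_ ?_ (hyX j hj)
  · intro i hi
    rw [hag' i hi.le, h1 i hi]
  · rw [hag' n le_rfl]; exact h2

theorem isCompact_X : IsCompact (betaShift β w) := isClosed_X.isCompact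

/-- uniform continuity on cylinders -/
theorem unif {f : SeqSpace (Fin ⌈β⌉₊) → ℝ} (hfc : ContinuousOn f (betaShift β w)) {ε : ℝ}
    (hε : 0 < ε) : ∃ m : ℕ, ∀ x ∈ betaShift β w, ∀ y ∈ betaShift β w,
      (∀ i < m, x i = y i) → |f x - f y| ≤ ε := by
  have huc := isCompact_X.uniformContinuousOn_of_continuous hfc
  rw [Metric.uniformContinuousOn_iff] at huc
  obtain ⟨δ, hδ, h⟩ := huc ε hε
  obtain ⟨n, hn⟩ : ∃ n : ℕ, Real.exp (-(n : ℝ)) < δ := by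
    have : Tendsto (fun n : ℕ => Real.exp (-(n : ℝ))) atTop (nhds 0) :=
      Real.tendsto_exp_neg_atTop_nhds_zero.comp tendsto_natCast_atTop_atTop
    exact (this.eventually (gt_mem_nhds hδ)).exists
  refine ⟨n, fun x hx y hy hxy => ?_⟩
  have := h x hx y hy (lt_of_le_of_lt (dist_le_of_agree x y n hxy) hn)
  rw [Real.dist_eq] at this
  exact this.le

theorem bounds {f : SeqSpace (Fin ⌈β⌉₊) → ℝ} (hfc : ContinuousOn f (betaShift β w))
    (hfpos : ∀ x ∈ betaShift β w, 0 < f x) :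
    ∃ c M : ℝ, 0 < c ∧ 0 < M ∧ ∀ x ∈ betaShift β w, c ≤ f x ∧ f x ≤ M := by
  rcases (betaShift β w).eq_empty_or_nonempty with he | hne
  · exact ⟨1, 1, one_pos, one_pos, by simp [he]⟩
  · obtain ⟨x, hx, hxm⟩ := isCompact_X.exists_isMinOn hne hfc
    obtain ⟨y, hy, hym⟩ := isCompact_X.exists_isMaxOn hne hfc
    exact ⟨f x, f y, hfpos x hx, hfpos y hy, fun z hz => ⟨hxm hz, hym hz⟩⟩

/-- quasi-greedy remainders -/
def rem (β : ℝ) : ℕ → ℝ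
  | 0 => 1
  | n + 1 => β * rem β n - ((⌈β * rem β n⌉₊ - 1 : ℕ) : ℝ)

theorem rem_bd (hβ : 1 < β) (n : ℕ) : 0 < rem β n ∧ rem β n ≤ 1 := by
  induction n with
  | zero => simp [rem]
  | succ n ih =>
    have h0 : 0 < β * rem β n := by have := ih.1; positivity
    have h1 : 1 ≤ ⌈β * rem β n⌉₊ := Nat.one_le_iff_ne_zero.mpr (by
      rw [Ne, Nat.ceil_eq_zero]; linarith)
    have h2 := Nat.ceil_lt_add_one h0.le
    have h3 := Nat.le_ceil (β * rem β n)
    rw [rem]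
    push_cast [Nat.cast_sub h1]
    constructor <;> linarith

theorem w_pos (hβ : 1 < β)
    (hwmax : ∀ v : SeqSpace (Fin ⌈β⌉₊),
      (∑' j : ℕ, ((v j : ℕ) : ℝ) / β ^ (j + 1)) = 1 → LexLe v w) : 0 < (w 0 : ℕ) := by
  have hβ0 : 0 < β := by linarith
  have hdig : ∀ n, ⌈β * rem β n⌉₊ - 1 < ⌈β⌉₊ := by
    intro n
    have h1 : ⌈β * rem β n⌉₊ ≤ ⌈β⌉₊ := Nat.ceil_le_ceil (by nlinarith [(rem_bd hβ n).2])
    have h2 : 0 < ⌈β⌉₊ := Nat.ceil_pos.mpr hβ0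
    omega
  let v : SeqSpace (Fin ⌈β⌉₊) := fun n => ⟨⌈β * rem β n⌉₊ - 1, hdig n⟩
  have hpart : ∀ n, ∑ j ∈ Finset.range n, ((v j : ℕ) : ℝ) / β ^ (j + 1)
      = 1 - rem β n / β ^ n := by
    intro n
    induction n with
    | zero => simp [rem]
    | succ n ih =>
      rw [Finset.sum_range_succ, ih]
      show 1 - rem β n / β ^ n + ((⌈β * rem β n⌉₊ - 1 : ℕ) : ℝ) / β ^ (n + 1) =
        1 - (β * rem β n - ((⌈β * rem β n⌉₊ - 1 : ℕ) : ℝ)) / β ^ (n + 1)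
      field_simp
      ring
  have hlim : Tendsto (fun n => ∑ j ∈ Finset.range n, ((v j : ℕ) : ℝ) / β ^ (j + 1)) atTop
      (nhds 1) := by
    simp_rw [hpart]
    have h1 : Tendsto (fun n => rem β n / β ^ n) atTop (nhds 0) := by
      refine squeeze_zero (g := fun n => (β⁻¹) ^ n) (fun n => ?_) (fun n => ?_)
        (tendsto_pow_atTop_nhds_zero_of_lt_one (by positivity) (inv_lt_one_of_one_lt₀ hβ))
      · have := (rem_bd hβ n).1; positivity
      · rw [inv_pow, div_eq_mul_inv]
        exact mul_le_of_le_one_left (by positivity) (rem_bd hβ n).2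
    simpa using tendsto_const_nhds.sub h1
  have hs : HasSum (fun j => ((v j : ℕ) : ℝ) / β ^ (j + 1)) 1 :=
    (hasSum_iff_tendsto_nat_of_nonneg (fun i => by positivity) 1).mpr hlim
  have hv0 : 0 < (v 0 : ℕ) := by
    show 0 < ⌈β * rem β 0⌉₊ - 1
    have : 1 < ⌈β⌉₊ := Nat.lt_ceil.mpr (by simpa using hβ)
    simp only [rem, mul_one]
    omega
  rcases hwmax v hs.tsum_eq with h | ⟨n, h1, h2⟩
  · rw [← h]; exact hv0
  · rcases Nat.eq_zero_or_pos n with h0 | h0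
    · subst h0; exact lt_of_le_of_lt (Nat.zero_le _) h2
    · rw [← h1 0 h0]; exact hv0

end X

end BetaRec

namespace BetaRec

section moran

/-- level of a block index -/
def lev (N Q i : ℕ) : ℕ := Nat.log Q (i / N)

/-- block indices at which an earlier block gets copied -/
def forced (N j Q i : ℕ) : Prop :=
  (N ≤ i ∧ 0 < N * Q ^ lev N Q i) ∧ i < (N + j) * Q ^ lev N Q i

instance (N j Q : ℕ) : DecidablePred (forced N j Q) := fun i => by
  unfold forced; infer_instance

/-- the block sequence built from the free sequence `y` -/
def bs (N j Q : ℕ) {b : ℕ} (y : ℕ → Fin b) (i : ℕ) : Fin b :=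
  if h : forced N j Q i then bs N j Q y (i - N * Q ^ lev N Q i)
  else y (Nat.count (fun i => ¬ forced N j Q i) i)
termination_by i
decreasing_by
  obtain ⟨⟨h1, h2⟩, _⟩ := h
  have : 0 < N := Nat.pos_of_mul_pos_right h2
  omega

theorem lev_spec {N Q i : ℕ} (hN : 0 < N) (hQ : 1 < Q) (hi : N ≤ i) :
    N * Q ^ lev N Q i ≤ i ∧ i < N * Q ^ (lev N Q i + 1) := by
  have h0 : i / N ≠ 0 := by
    rw [Ne, Nat.div_eq_zero_iff]; omega
  have h1 := Nat.pow_log_le_self Q h0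
  have h2 := Nat.lt_pow_succ_log_self hQ (i / N)
  unfold lev
  constructor
  · calc N * Q ^ Nat.log Q (i / N) ≤ N * (i / N) := Nat.mul_le_mul_left _ h1
      _ ≤ i := Nat.mul_div_le i N
  · rw [Nat.div_lt_iff_lt_mul hN] at h2
    rw [mul_comm]; exact h2

theorem lev_eq {N Q i k : ℕ} (hN : 0 < N) (hQ : 1 < Q) (h1 : N * Q ^ k ≤ i)
    (h2 : i < N * Q ^ (k + 1)) : lev N Q i = k := by
  unfold lev
  rw [Nat.log_eq_iff (Or.inr ⟨hQ, ?_⟩)]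
  · constructor
    · rw [Nat.le_div_iff_mul_le hN, mul_comm]; exact h1
    · rw [Nat.div_lt_iff_lt_mul hN, mul_comm]; exact h2
  · have : 0 < Q ^ k := by positivity
    rw [Ne, Nat.div_eq_zero_iff]
    have : N * 1 ≤ N * Q ^ k := Nat.mul_le_mul_left _ this
    omega

theorem bs_copy {N j Q b : ℕ} (hN : 0 < N) (hQ : 1 < Q) (hQ2 : N + j ≤ Q) (y : ℕ → Fin b)
    (k l : ℕ) (hl : l < j * Q ^ k) : bs N j Q y (N * Q ^ k + l) = bs N j Q y l := by
  have hq : 0 < Q ^ k := by positivity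
  have hlev : lev N Q (N * Q ^ k + l) = k := by
    apply lev_eq hN hQ (by omega)
    calc N * Q ^ k + l < N * Q ^ k + j * Q ^ k := by omega
      _ = (N + j) * Q ^ k := by ring
      _ ≤ Q * Q ^ k := Nat.mul_le_mul_right _ hQ2
      _ = 1 * Q ^ (k + 1) := by ring
      _ ≤ N * Q ^ (k + 1) := Nat.mul_le_mul_right _ hN
  have hf : forced N j Q (N * Q ^ k + l) := by
    refine ⟨⟨?_, ?_⟩, ?_⟩
    · have : N * 1 ≤ N * Q ^ k := Nat.mul_le_mul_left _ hq
      omega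
    · rw [hlev]; positivity
    · rw [hlev, add_mul]; omega
  rw [bs, dif_pos hf, hlev]
  congr 1
  omega

theorem agree_free {N j Q b : ℕ} (y y' : ℕ → Fin b) (M : ℕ)
    (h : ∀ i < M, bs N j Q y i = bs N j Q y' i) :
    ∀ n < Nat.count (fun i => ¬ forced N j Q i) M, y n = y' n := by
  intro n hn
  induction M with
  | zero => simp at hn
  | succ M ih =>
    rw [Nat.count_succ] at hn
    by_cases hlt : n < Nat.count (fun i => ¬ forced N j Q i) M
    · exact ih (fun i hi => h i (by omega)) hlt
    · by_cases hM : forced N j Q M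
      · rw [if_neg (not_not.mpr hM)] at hn
        omega
      · rw [if_pos hM] at hn
        have : n = Nat.count (fun i => ¬ forced N j Q i) M := by omega
        have hb := h M (by omega)
        rw [bs, dif_neg hM, bs, dif_neg hM] at hb
        rw [this]; exact hb

theorem count_forced_le {N j Q : ℕ} (hN : 0 < N) (hQ : 1 < Q) (M k : ℕ)
    (hk : M ≤ N * Q ^ (k + 1)) :
    Nat.count (forced N j Q) M ≤
      (∑ i ∈ Finset.range k, j * Q ^ i) + (min M ((N + j) * Q ^ k) - N * Q ^ k) := by
  rw [Nat.count_eq_card_filter_range]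
  have hsub : (Finset.range M).filter (forced N j Q) ⊆
      ((Finset.range k).biUnion fun i => Finset.Ico (N * Q ^ i) ((N + j) * Q ^ i)) ∪
        Finset.Ico (N * Q ^ k) (min M ((N + j) * Q ^ k)) := by
    intro i hi
    simp only [Finset.mem_filter, Finset.mem_range] at hi
    obtain ⟨hiM, ⟨hNi, _⟩, hlt⟩ := hi
    obtain ⟨h1, h2⟩ := lev_spec hN hQ hNi
    simp only [Finset.mem_union, Finset.mem_biUnion, Finset.mem_range, Finset.mem_Ico, lt_min_iff]
    have hlk : lev N Q i ≤ k := by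
      have : N * Q ^ lev N Q i < N * Q ^ (k + 1) := by omega
      have := Nat.lt_of_mul_lt_mul_left this
      have := (Nat.pow_lt_pow_iff_right hQ).mp this
      omega
    rcases hlk.lt_or_eq with h | h
    · exact Or.inl ⟨_, h, h1, hlt⟩
    · rw [h] at h1 hlt
      exact Or.inr ⟨h1, hiM, hlt⟩
  refine (Finset.card_le_card hsub).trans ((Finset.card_union_le _ _).trans ?_)
  refine add_le_add (Finset.card_biUnion_le.trans ?_) (by simp)
  apply Finset.sum_le_sum
  intro i _
  simp [add_mul]

theorem count_free {N j Q : ℕ} (hN : 0 < N) (hQ : 1 < Q) {η : ℝ} (hη : 0 ≤ η)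
    (hQη : ((N : ℝ) + j) * j ≤ η * N ^ 2 * (Q - 1)) (M : ℕ) :
    (1 - η) * N * M ≤ ((N : ℝ) + j) * (Nat.count (fun i => ¬ forced N j Q i) M : ℕ) := by
  have hNr : (0 : ℝ) < N := by exact_mod_cast hN
  have htot : Nat.count (forced N j Q) M + Nat.count (fun i => ¬ forced N j Q i) M = M := by
    rw [Nat.count_eq_card_filter_range, Nat.count_eq_card_filter_range,
      Finset.card_filter_add_card_filter_not, Finset.card_range]
  have htot' : ((Nat.count (fun i => ¬ forced N j Q i) M : ℕ) : ℝ) =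
      M - (Nat.count (forced N j Q) M : ℕ) := by
    rw [eq_sub_iff_add_eq, add_comm]; exact_mod_cast htot
  rw [htot']
  have hMr : (0 : ℝ) ≤ M := Nat.cast_nonneg _
  have hjr : (0 : ℝ) ≤ j := Nat.cast_nonneg _
  have hηNM : 0 ≤ η * N * M := by positivity
  rcases Nat.lt_or_ge M N with hMN | hMN
  · have : Nat.count (forced N j Q) M = 0 := by
      rw [Nat.count_eq_card_filter_range, Finset.card_eq_zero, Finset.filter_eq_empty_iff]
      intro i hi hf
      have := Finset.mem_range.mp hi
      have := hf.1.1
      omega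
    rw [this]
    push_cast
    nlinarith [mul_nonneg hjr hMr]
  · obtain ⟨h1, h2⟩ := lev_spec hN hQ hMN
    set k := lev N Q M
    have hc := count_forced_le (j := j) hN hQ M k h2.le
    set q := Q ^ k with hq
    have hqpos : 0 < q := by positivity
    have hcr : ((Nat.count (forced N j Q) M : ℕ) : ℝ) ≤
        (∑ i ∈ Finset.range k, (j : ℝ) * (Q : ℝ) ^ i) +
          (min (M : ℝ) (((N : ℝ) + j) * q) - N * q) := by
      have hle : N * q ≤ min M ((N + j) * q) := by
        rw [le_min_iff]; exact ⟨h1, Nat.mul_le_mul_right _ (by omega)⟩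
      have : ((Nat.count (forced N j Q) M : ℕ) : ℝ) ≤
        (((∑ i ∈ Finset.range k, j * Q ^ i) + (min M ((N + j) * q) - N * q) : ℕ) : ℝ) := by
        exact_mod_cast hc
      push_cast [Nat.cast_sub hle] at this
      exact this
    rw [← Finset.mul_sum] at hcr
    have hgeom := geom_sum_mul (Q : ℝ) k
    set S := ∑ i ∈ Finset.range k, (Q : ℝ) ^ i
    have hS : 0 ≤ S := Finset.sum_nonneg fun i _ => by positivity
    have hqr : ((q : ℕ) : ℝ) = (Q : ℝ) ^ k := by rw [hq]; push_cast; rfl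
    rw [← hqr] at hgeom
    have h1r : (N : ℝ) * q ≤ M := by exact_mod_cast h1
    have hmin : ((N : ℝ) + j) * (min (M : ℝ) (((N : ℝ) + j) * q) - N * q) ≤ j * M := by
      set m := min (M : ℝ) (((N : ℝ) + j) * q)
      have ha : m ≤ M := min_le_left _ _
      have hb : m ≤ ((N : ℝ) + j) * q := min_le_right _ _
      nlinarith [mul_le_mul_of_nonneg_left ha hjr, mul_le_mul_of_nonneg_left hb hNr.le]
    have hS2 : ((N : ℝ) + j) * (j * S) ≤ η * N * M := by
      have e1 : ((N : ℝ) + j) * (j * S) ≤ η * N ^ 2 * (Q - 1) * S := by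
        have := mul_le_mul_of_nonneg_right hQη hS
        linarith
      have e2 : η * N ^ 2 * (Q - 1) * S = η * N ^ 2 * (q - 1) := by
        rw [← hgeom]; ring
      have e3 : η * N ^ 2 * ((q : ℝ) - 1) ≤ η * N * M := by
        have : η * N * (N * q) ≤ η * N * M := mul_le_mul_of_nonneg_left h1r (by positivity)
        have : 0 ≤ η * (N : ℝ) ^ 2 := by positivity
        nlinarith
      linarith
    have hNj : 0 ≤ (N : ℝ) + j := by positivity
    have := mul_le_mul_of_nonneg_left hcr hNj
    nlinarith

/-- A Moran-type lower bound for the dimension of a set which is coded in a Hölder way. -/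
theorem dim_of_coding {Y : Type*} [MetricSpace Y] {b : ℕ} (hb : 1 < b) (pt : (ℕ → Fin b) → Y)
    (C t : ℝ≥0) (ht : 0 < t)
    (h : ∀ y y', |Real.ofDigits y - Real.ofDigits y'| ≤ C * dist (pt y) (pt y') ^ (t : ℝ)) :
    (t : ℝ≥0∞) ≤ dimH (range pt) := by
  have : Nonempty (ℕ → Fin b) := ⟨fun _ => ⟨0, by omega⟩⟩
  let g : Y → ℝ := fun x => Real.ofDigits (Function.invFun pt x)
  have hg : ∀ y, g (pt y) = Real.ofDigits y := by
    intro y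
    have h1 := h (Function.invFun pt (pt y)) y
    rw [Function.invFun_eq (f := pt) ⟨y, rfl⟩, dist_self, Real.zero_rpow (by positivity), mul_zero] at h1
    have := abs_nonpos_iff.mp h1
    show Real.ofDigits (Function.invFun pt (pt y)) = Real.ofDigits y
    linarith
  have hhol : HolderOnWith C t g (range pt) := by
    rintro _ ⟨y, rfl⟩ _ ⟨y', rfl⟩
    have h1 := h y y'
    rw [hg, hg, edist_dist, edist_dist, Real.dist_eq,
      ENNReal.ofReal_rpow_of_nonneg dist_nonneg t.coe_nonneg, ← ENNReal.ofReal_coe_nnreal,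
      ← ENNReal.ofReal_mul C.coe_nonneg]
    exact ENNReal.ofReal_le_ofReal h1
  have h1 := hhol.dimH_image_le ht
  have h2 : dimH (g '' range pt) = 1 := by
    have hsub : Icc (0 : ℝ) 1 ⊆ g '' range pt := by
      intro z hz
      obtain ⟨y, -, hy⟩ := Real.ofDigits_SurjOn hb hz
      exact ⟨pt y, ⟨y, rfl⟩, by rw [hg, hy]⟩
    have := Real.dimH_of_nonempty_interior (E := ℝ) (s := g '' range pt)
      ⟨1 / 2, interior_mono hsub (by rw [interior_Icc]; constructor <;> norm_num)⟩
    simpa using this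
  rw [h2] at h1
  rw [ENNReal.le_div_iff_mul_le (Or.inl (by simpa using ht.ne')) (Or.inl ENNReal.coe_ne_top),
    one_mul] at h1
  exact h1

end moran

theorem core {β : ℝ} {w : SeqSpace (Fin ⌈β⌉₊)} {f : SeqSpace (Fin ⌈β⌉₊) → ℝ}
    {N j b : ℕ} (hN : 0 < N) (hb : 1 < b) (block : Fin b → ℕ → Fin ⌈β⌉₊)
    (hinj : ∀ e e', (∀ i < N, block e i = block e' i) → e = e')
    (hG : ∀ e, ∀ i < N, ∃ p < N, i ≤ p ∧ (∀ l, i ≤ l → l < p → block e l = w (l - i)) ∧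
      block e p < w (p - i))
    (hcost : ∀ e, ∀ x ∈ betaShift β w, (∀ i < N, x i = block e i) → birkhoff f N x ≤ j)
    {t η : ℝ} (ht : 0 < t) (hη : 0 < η) (hη1 : η < 1)
    (hbt : Real.exp (t * (N + j)) ≤ b) :
    ENNReal.ofReal (t * (1 - η)) ≤ dimH (recSetF (betaShift β w) f) := by
  have hNr : (0 : ℝ) < N := by exact_mod_cast hN
  obtain ⟨Q, hQ, hQ2, hQη⟩ : ∃ Q : ℕ, 1 < Q ∧ N + j ≤ Q ∧
      ((N : ℝ) + j) * j ≤ η * N ^ 2 * (Q - 1) := by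
    obtain ⟨Q, hQ⟩ := exists_nat_ge (((N : ℝ) + j) * j / (η * N ^ 2) + 1)
    refine ⟨Q + N + j + 2, by omega, by omega, ?_⟩
    have h1 : ((N : ℝ) + j) * j / (η * N ^ 2) ≤ ((Q + N + j + 2 : ℕ) : ℝ) - 1 := by
      push_cast
      have : (0 : ℝ) ≤ j := Nat.cast_nonneg _
      linarith
    rw [div_le_iff₀ (by positivity)] at h1
    linarith
  let pt : (ℕ → Fin b) → SeqSpace (Fin ⌈β⌉₊) := fun y n => block (bs N j Q y (n / N)) (n % N)
  have hpt : ∀ y n, pt y n = block (bs N j Q y (n / N)) (n % N) := fun _ _ => rfl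
  have hptb : ∀ y i l, l < N → pt y (N * i + l) = block (bs N j Q y i) l := by
    intro y i l hl
    rw [hpt, Nat.mul_add_div hN, Nat.mul_add_mod, Nat.div_eq_of_lt hl, Nat.mod_eq_of_lt hl,
      add_zero]
  have hX : ∀ y, pt y ∈ betaShift β w := by
    intro y n _
    obtain ⟨p, hpN, hip, h1, h2⟩ := hG (bs N j Q y (n / N)) (n % N) (Nat.mod_lt _ hN)
    refine Or.inr ⟨p - n % N, ?_, ?_⟩
    · intro l hl
      have hn : n + l = N * (n / N) + (n % N + l) := by rw [← add_assoc, Nat.div_add_mod]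
      rw [shift_iter, hn, hptb _ _ _ (by omega), h1 _ (by omega) (by omega)]
      congr 1
      omega
    · have hn : n + (p - n % N) = N * (n / N) + p := by
        have := Nat.div_add_mod n N
        omega
      rw [shift_iter, hn, hptb _ _ _ hpN]
      exact h2
  have hbirk : ∀ y m, birkhoff f (N * m) (pt y) ≤ m * j := by
    intro y m
    induction m with
    | zero => simp [birkhoff]
    | succ m ih =>
      rw [Nat.mul_succ, birkhoff_add]
      have := hcost (bs N j Q y m) (shift^[N * m] (pt y)) (shift_mem (hX y) _) (by
        intro i hi
        rw [shift_iter, hptb _ _ _ hi])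
      push_cast
      linarith
  have hrec : range pt ⊆ recSetF (betaShift β w) f := by
    rintro _ ⟨y, rfl⟩
    refine ⟨hX y, ?_⟩
    rw [frequently_atTop]
    intro a
    refine ⟨N * (N * Q ^ a), ?_, ?_⟩
    · have h1 : a < Q ^ a := Nat.lt_pow_self hQ
      have h2 : Q ^ a ≤ N * Q ^ a := Nat.le_mul_of_pos_left _ hN
      have h3 : N * Q ^ a ≤ N * (N * Q ^ a) := Nat.le_mul_of_pos_left _ hN
      omega
    · refine (dist_le_of_agree _ _ (N * (j * Q ^ a)) ?_).trans ?_
      · intro i hi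
        rw [shift_iter]
        have hi1 : i / N < j * Q ^ a := by
          rw [Nat.div_lt_iff_lt_mul hN, mul_comm]; exact hi
        rw [hpt, hpt, Nat.mul_add_div hN, Nat.mul_add_mod, bs_copy hN hQ hQ2 y a _ hi1]
      · apply Real.exp_le_exp.mpr
        have := hbirk y (N * Q ^ a)
        push_cast at this ⊢
        linarith
  refine le_trans ?_ (dimH_mono hrec)
  set t' := t * (1 - η) with ht'
  have ht'pos : 0 < t' := mul_pos ht (by linarith)
  have key : ∀ y y' L, (∀ i < L, pt y i = pt y' i) →
      |Real.ofDigits y - Real.ofDigits y'| ≤ Real.exp (t' * N) * Real.exp (-(L : ℝ) * t') := by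
    intro y y' L hL
    have hbl : ∀ i < L / N, bs N j Q y i = bs N j Q y' i := by
      intro i hi
      apply hinj
      intro l hl
      rw [← hptb _ _ _ hl, ← hptb _ _ _ hl]
      apply hL
      have h1 : N * (i + 1) ≤ N * (L / N) := Nat.mul_le_mul_left _ hi
      have h2 := Nat.mul_div_le L N
      rw [Nat.mul_succ] at h1
      omega
    have h1 := Real.abs_ofDigits_sub_ofDigits_le (agree_free y y' (L / N) hbl)
    refine h1.trans ?_
    set F := Nat.count (fun i => ¬ forced N j Q i) (L / N) with hF
    have hcf := count_free hN hQ hη.le hQη (L / N)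
    rw [← hF] at hcf
    have h2 : Real.exp (t * (N + j)) ^ F ≤ (b : ℝ) ^ F :=
      pow_le_pow_left₀ (Real.exp_pos _).le hbt _
    have h3 : ((b : ℝ) ^ F)⁻¹ ≤ (Real.exp (t * (N + j)) ^ F)⁻¹ :=
      inv_anti₀ (by positivity) h2
    refine h3.trans ?_
    rw [← Real.exp_nat_mul, ← Real.exp_neg, ← Real.exp_add]
    apply Real.exp_le_exp.mpr
    have h4 : (L : ℝ) ≤ N * ((L / N : ℕ) : ℝ) + N := by
      have h5 : L ≤ N * (L / N) + N := by
        have := Nat.div_add_mod L N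
        have := Nat.mod_lt L hN
        omega
      exact_mod_cast h5
    have h6 := mul_le_mul_of_nonneg_left hcf ht.le
    have h7 := mul_le_mul_of_nonneg_left h4 ht'pos.le
    rw [ht'] at h7 ⊢
    linarith
  have := dim_of_coding hb pt ⟨Real.exp (t' * N), (Real.exp_pos _).le⟩ ⟨t', ht'pos.le⟩ ht'pos (by
    intro y y'
    show _ ≤ Real.exp (t' * N) * dist (pt y) (pt y') ^ t'
    by_cases hyy : pt y = pt y'
    · rw [hyy, dist_self, Real.zero_rpow ht'pos.ne', mul_zero]
      have hlim : Tendsto (fun L : ℕ => Real.exp (t' * N) * Real.exp (-(L : ℝ) * t')) atTop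
          (nhds (Real.exp (t' * N) * 0)) := by
        apply Tendsto.const_mul
        apply Real.tendsto_exp_atBot.comp
        apply Tendsto.atBot_mul_const ht'pos
        exact tendsto_neg_atTop_atBot.comp tendsto_natCast_atTop_atTop
      rw [mul_zero] at hlim
      exact ge_of_tendsto' hlim (fun L => key y y' L (fun i _ => by rw [hyy]))
    · have hd : dist (pt y) (pt y') = Real.exp (-(lcp (pt y) (pt y') : ℝ)) := by
        rw [dist_def, sdist, if_neg hyy]
      rw [hd, ← Real.exp_mul]
      apply key
      intro i hi
      simpa using Nat.notMem_of_lt_sInf hi)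
  refine le_trans (le_of_eq ?_) this
  rw [ENNReal.ofReal, Real.toNNReal_of_nonneg ht'pos.le]
  rfl

end BetaRec

namespace BetaRec

section press
variable {β : ℝ} {w : SeqSpace (Fin ⌈β⌉₊)} {f : SeqSpace (Fin ⌈β⌉₊) → ℝ}

theorem finite_words (β : ℝ) (w : SeqSpace (Fin ⌈β⌉₊)) (n : ℕ) :
    (wordsOfLen (language (betaShift β w)) n).Finite :=
  (List.finite_length_eq (Fin ⌈β⌉₊) n).subset fun _ hv => hv.2

/-- words of length `n` -/
def WF (β : ℝ) (w : SeqSpace (Fin ⌈β⌉₊)) (n : ℕ) : Finset (List (Fin ⌈β⌉₊)) :=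
  (finite_words β w n).toFinset

theorem mem_WF {n : ℕ} {v : List (Fin ⌈β⌉₊)} :
    v ∈ WF β w n ↔ v ∈ language (betaShift β w) ∧ v.length = n := by
  simp [WF, wordsOfLen]

theorem card_WF (n : ℕ) : (WF β w n).card ≤ ⌈β⌉₊ ^ n := by
  have : WF β w n ⊆ (Finset.univ : Finset (Fin n → Fin ⌈β⌉₊)).image List.ofFn := by
    intro v hv
    have hl := (mem_WF.mp hv).2
    subst hl
    exact Finset.mem_image.mpr ⟨v.get, Finset.mem_univ _, List.ofFn_get v⟩
  refine (Finset.card_le_card this).trans (Finset.card_image_le.trans ?_)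
  simp

/-- sup of the Birkhoff sums on a cylinder -/
def SB (w : SeqSpace (Fin ⌈β⌉₊)) (f : SeqSpace (Fin ⌈β⌉₊) → ℝ) (s : ℝ) (n : ℕ)
    (v : List (Fin ⌈β⌉₊)) : ℝ :=
  sSup (birkhoff (fun x => -(s * (f x + 1))) n '' (betaShift β w ∩ cyl v))

/-- partition function -/
def ZZ (w : SeqSpace (Fin ⌈β⌉₊)) (f : SeqSpace (Fin ⌈β⌉₊) → ℝ) (s : ℝ) (n : ℕ) : ℝ :=
  ∑ v ∈ WF β w n, Real.exp (SB w f s n v)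

/-- the pressure function -/
def pr (w : SeqSpace (Fin ⌈β⌉₊)) (f : SeqSpace (Fin ⌈β⌉₊) → ℝ) (s : ℝ) : ℝ :=
  atTop.limsup fun n : ℕ => Real.log (ZZ w f s n) / n

theorem pressure_eq (s : ℝ) : pressure (betaShift β w) (language (betaShift β w))
    (fun x => -(s * (f x + 1))) = pr w f s := by
  unfold pressure pr
  congr 1
  ext n
  rw [finsum_mem_eq_finite_toFinset_sum _ (finite_words β w n)]
  rfl

theorem ofFn_mem {x : SeqSpace (Fin ⌈β⌉₊)} (hx : x ∈ betaShift β w) (n : ℕ) :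
    List.ofFn (fun i : Fin n => x i) ∈ WF β w n ∧ x ∈ cyl (List.ofFn (fun i : Fin n => x i)) := by
  have : x ∈ cyl (List.ofFn (fun i : Fin n => x i)) := by
    rw [cyl_iff]; intro i h; simp
  exact ⟨mem_WF.mpr ⟨⟨x, hx, 0, this⟩, by simp⟩, this⟩

theorem cyl_nonempty {n : ℕ} {v : List (Fin ⌈β⌉₊)} (hv : v ∈ WF β w n) :
    (betaShift β w ∩ cyl v).Nonempty := by
  obtain ⟨⟨x, hx, k, hk⟩, _⟩ := mem_WF.mp hv
  refine ⟨shift^[k] x, shift_mem hx k, ?_⟩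
  rw [cyl_iff]
  intro i hi
  rw [shift_iter]
  exact hk i hi

variable {c M : ℝ}

theorem birk_bounds (hcM : ∀ x ∈ betaShift β w, c ≤ f x ∧ f x ≤ M)
    {x : SeqSpace (Fin ⌈β⌉₊)} (hx : x ∈ betaShift β w) (n : ℕ) :
    c * n ≤ birkhoff f n x ∧ birkhoff f n x ≤ M * n := by
  unfold birkhoff
  constructor
  · have := Finset.card_nsmul_le_sum (Finset.range n) (fun k => f (shift^[k] x)) c
      (fun k _ => (hcM _ (shift_mem hx k)).1)
    simpa [mul_comm] using this
  · have := Finset.sum_le_card_nsmul (Finset.range n) (fun k => f (shift^[k] x)) M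
      (fun k _ => (hcM _ (shift_mem hx k)).2)
    simpa [mul_comm] using this

theorem bdd_SB (hc : 0 < c) (hcM : ∀ x ∈ betaShift β w, c ≤ f x ∧ f x ≤ M) {s : ℝ} (hs : 0 ≤ s)
    (n : ℕ) (v : List (Fin ⌈β⌉₊)) :
    BddAbove (birkhoff (fun x => -(s * (f x + 1))) n '' (betaShift β w ∩ cyl v)) := by
  refine ⟨0, ?_⟩
  rintro _ ⟨x, ⟨hx, _⟩, rfl⟩
  rw [birkhoff_phi]
  have := (birk_bounds hcM hx n).1
  have : 0 ≤ birkhoff f n x + n := by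
    have : 0 ≤ c * n := by positivity
    have : (0 : ℝ) ≤ n := Nat.cast_nonneg _
    linarith
  have := mul_nonneg hs this
  linarith

theorem le_SB (hc : 0 < c) (hcM : ∀ x ∈ betaShift β w, c ≤ f x ∧ f x ≤ M) {s : ℝ} (hs : 0 ≤ s)
    {n : ℕ} {v : List (Fin ⌈β⌉₊)} {x : SeqSpace (Fin ⌈β⌉₊)} (hx : x ∈ betaShift β w)
    (hv : x ∈ cyl v) : -(s * (birkhoff f n x + n)) ≤ SB w f s n v := by
  rw [← birkhoff_phi]
  exact le_csSup (bdd_SB hc hcM hs n v) ⟨x, ⟨hx, hv⟩, rfl⟩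

theorem SB_le {s : ℝ} {n : ℕ} {v : List (Fin ⌈β⌉₊)} (hv : v ∈ WF β w n) {B : ℝ}
    (h : ∀ x ∈ betaShift β w, x ∈ cyl v → -(s * (birkhoff f n x + n)) ≤ B) :
    SB w f s n v ≤ B := by
  apply csSup_le ((cyl_nonempty hv).image _)
  rintro _ ⟨x, ⟨hx, hxv⟩, rfl⟩
  rw [birkhoff_phi]
  exact h x hx hxv

theorem ZZ_pos (hne : (betaShift β w).Nonempty) (s : ℝ) (n : ℕ) : 0 < ZZ w f s n := by
  obtain ⟨x, hx⟩ := hne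
  exact Finset.sum_pos (fun _ _ => Real.exp_pos _) ⟨_, (ofFn_mem hx n).1⟩

theorem ZZ_upper (hc : 0 < c) (hcM : ∀ x ∈ betaShift β w, c ≤ f x ∧ f x ≤ M)
    {s s' : ℝ} (hs : 0 ≤ s) (hss : s ≤ s') (n : ℕ) :
    ZZ w f s' n ≤ Real.exp (-((s' - s) * (c + 1)) * n) * ZZ w f s n := by
  unfold ZZ
  rw [Finset.mul_sum]
  apply Finset.sum_le_sum
  intro v hv
  rw [← Real.exp_add]
  apply Real.exp_le_exp.mpr
  apply SB_le hv
  intro x hx hxv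
  have h1 := le_SB (n := n) hc hcM hs hx hxv
  have h2 := (birk_bounds hcM hx n).1
  have h3 : (s' - s) * (c * n + n) ≤ (s' - s) * (birkhoff f n x + n) :=
    mul_le_mul_of_nonneg_left (by linarith) (by linarith)
  linarith

theorem ZZ_lower (hc : 0 < c) (hcM : ∀ x ∈ betaShift β w, c ≤ f x ∧ f x ≤ M)
    {s s' : ℝ} (hs : 0 ≤ s) (hss : s ≤ s') (n : ℕ) :
    ZZ w f s n ≤ Real.exp (((s' - s) * (M + 1)) * n) * ZZ w f s' n := by
  unfold ZZ
  rw [Finset.mul_sum]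
  apply Finset.sum_le_sum
  intro v hv
  rw [← Real.exp_add]
  apply Real.exp_le_exp.mpr
  apply SB_le hv
  intro x hx hxv
  have h1 := le_SB (n := n) hc hcM (hs.trans hss) hx hxv
  have h2 := (birk_bounds hcM hx n).2
  have h3 : (s' - s) * (birkhoff f n x + n) ≤ (s' - s) * (M * n + n) :=
    mul_le_mul_of_nonneg_left (by linarith) (by linarith)
  linarith

theorem ZZ_zero_ge (hne : (betaShift β w).Nonempty) (n : ℕ) : 1 ≤ ZZ w f 0 n := by
  obtain ⟨x, hx⟩ := hne
  have hm := (ofFn_mem hx n).1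
  have h0 : ∀ v ∈ WF β w n, Real.exp (SB w f 0 n v) = 1 := by
    intro v hv
    have : birkhoff (fun x => -(0 * (f x + 1))) n '' (betaShift β w ∩ cyl v) = {0} := by
      have : birkhoff (fun x => -(0 * (f x + 1))) n = fun _ => 0 := by
        ext x; rw [birkhoff_phi]; simp
      rw [this]
      exact (cyl_nonempty hv).image_const 0
    rw [SB, this]; simp
  rw [ZZ, Finset.sum_congr rfl h0]
  simp only [Finset.sum_const, nsmul_eq_mul, mul_one]
  exact_mod_cast Finset.card_pos.mpr ⟨_, hm⟩

theorem ZZ_zero_le (n : ℕ) : ZZ w f 0 n ≤ (⌈β⌉₊ : ℝ) ^ n := by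
  have h0 : ∀ v ∈ WF β w n, Real.exp (SB w f 0 n v) ≤ 1 := by
    intro v hv
    rw [Real.exp_le_one_iff]
    apply SB_le hv
    simp
  refine (Finset.sum_le_sum h0).trans ?_
  simp only [Finset.sum_const, nsmul_eq_mul, mul_one]
  exact_mod_cast card_WF n

theorem log_bounds (hne : (betaShift β w).Nonempty) (hc : 0 < c)
    (hcM : ∀ x ∈ betaShift β w, c ≤ f x ∧ f x ≤ M) {s : ℝ} (hs : 0 ≤ s) (n : ℕ) (hn : 0 < n) :
    -(s * (M + 1)) ≤ Real.log (ZZ w f s n) / n ∧ Real.log (ZZ w f s n) / n ≤ Real.log ⌈β⌉₊ := by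
  have hnr : (0 : ℝ) < n := by exact_mod_cast hn
  have hZ := ZZ_pos (f := f) hne s n
  have hb0 : (0 : ℝ) < ⌈β⌉₊ := by
    obtain ⟨x, _⟩ := hne
    exact_mod_cast (x 0).pos
  constructor
  · rw [le_div_iff₀ hnr, Real.le_log_iff_exp_le hZ]
    have h1 := ZZ_lower hc hcM le_rfl hs n
    have h2 := ZZ_zero_ge (f := f) hne n
    have h3 : Real.exp (-((s * (M + 1)) * n)) * Real.exp ((s * (M + 1)) * n) = 1 := by
      rw [← Real.exp_add]; simp
    rw [sub_zero] at h1
    rw [neg_mul]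
    calc Real.exp (-((s * (M + 1)) * n)) = Real.exp (-((s * (M + 1)) * n)) * 1 := by ring
      _ ≤ Real.exp (-((s * (M + 1)) * n)) * (Real.exp ((s * (M + 1)) * n) * ZZ w f s n) :=
        mul_le_mul_of_nonneg_left (h2.trans h1) (Real.exp_pos _).le
      _ = ZZ w f s n := by rw [← mul_assoc, h3, one_mul]
  · rw [div_le_iff₀ hnr, mul_comm, ← Real.log_pow]
    apply Real.log_le_log hZ
    have h1 := ZZ_upper hc hcM le_rfl hs n
    refine h1.trans (le_trans ?_ (ZZ_zero_le (w := w) (f := f) n))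
    apply mul_le_of_le_one_left (ZZ_pos hne 0 n).le
    rw [Real.exp_le_one_iff]
    have : 0 ≤ (s - 0) * (c + 1) * n := by rw [sub_zero]; positivity
    linarith

theorem bdd_above_log (hne : (betaShift β w).Nonempty) (hc : 0 < c)
    (hcM : ∀ x ∈ betaShift β w, c ≤ f x ∧ f x ≤ M) {s : ℝ} (hs : 0 ≤ s) :
    IsBoundedUnder (· ≤ ·) atTop (fun n : ℕ => Real.log (ZZ w f s n) / n) :=
  isBoundedUnder_of_eventually_le ((eventually_gt_atTop 0).mono fun n hn =>
    (log_bounds hne hc hcM hs n hn).2)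

theorem bdd_below_log (hne : (betaShift β w).Nonempty) (hc : 0 < c)
    (hcM : ∀ x ∈ betaShift β w, c ≤ f x ∧ f x ≤ M) {s : ℝ} (hs : 0 ≤ s) :
    IsBoundedUnder (· ≥ ·) atTop (fun n : ℕ => Real.log (ZZ w f s n) / n) :=
  isBoundedUnder_of_eventually_ge ((eventually_gt_atTop 0).mono fun n hn =>
    (log_bounds hne hc hcM hs n hn).1)

theorem limsup_le_add {u v : ℕ → ℝ} {C : ℝ} (hu : IsBoundedUnder (· ≥ ·) atTop u)
    (hv : IsBoundedUnder (· ≤ ·) atTop v) (hv' : IsBoundedUnder (· ≥ ·) atTop v)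
    (h : ∀ᶠ n in atTop, u n ≤ v n + C) :
    limsup u atTop ≤ limsup v atTop + C := by
  apply le_of_forall_pos_le_add
  intro ε hε
  apply limsup_le_of_le hu.isCoboundedUnder_le
  have h2 := eventually_lt_of_limsup_lt (show limsup v atTop < limsup v atTop + ε by linarith) hv
  filter_upwards [h, h2] with n h3 h4
  linarith

theorem pr_upper (hne : (betaShift β w).Nonempty) (hc : 0 < c)
    (hcM : ∀ x ∈ betaShift β w, c ≤ f x ∧ f x ≤ M) {s s' : ℝ} (hs : 0 ≤ s) (hss : s ≤ s') :
    pr w f s' ≤ pr w f s + -((s' - s) * (c + 1)) := by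
  apply limsup_le_add (bdd_below_log hne hc hcM (hs.trans hss)) (bdd_above_log hne hc hcM hs)
    (bdd_below_log hne hc hcM hs)
  filter_upwards [eventually_gt_atTop 0] with n hn
  have hnr : (0 : ℝ) < n := by exact_mod_cast hn
  have h1 := Real.log_le_log (ZZ_pos hne _ _) (ZZ_upper hc hcM hs hss n)
  rw [Real.log_mul (Real.exp_pos _).ne' (ZZ_pos hne _ _).ne', Real.log_exp] at h1
  rw [div_le_iff₀ hnr, add_mul, div_mul_cancel₀ _ hnr.ne']
  linarith

theorem pr_lower (hne : (betaShift β w).Nonempty) (hc : 0 < c)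
    (hcM : ∀ x ∈ betaShift β w, c ≤ f x ∧ f x ≤ M) {s s' : ℝ} (hs : 0 ≤ s) (hss : s ≤ s') :
    pr w f s ≤ pr w f s' + (s' - s) * (M + 1) := by
  apply limsup_le_add (bdd_below_log hne hc hcM hs) (bdd_above_log hne hc hcM (hs.trans hss))
    (bdd_below_log hne hc hcM (hs.trans hss))
  filter_upwards [eventually_gt_atTop 0] with n hn
  have hnr : (0 : ℝ) < n := by exact_mod_cast hn
  have h1 := Real.log_le_log (ZZ_pos hne _ _) (ZZ_lower hc hcM hs hss n)
  rw [Real.log_mul (Real.exp_pos _).ne' (ZZ_pos hne _ _).ne', Real.log_exp] at h1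
  rw [div_le_iff₀ hnr, add_mul, div_mul_cancel₀ _ hnr.ne']
  linarith

theorem pr_zero (hne : (betaShift β w).Nonempty) (hc : 0 < c)
    (hcM : ∀ x ∈ betaShift β w, c ≤ f x ∧ f x ≤ M) : 0 ≤ pr w f 0 := by
  apply le_limsup_of_frequently_le _ (bdd_above_log hne hc hcM le_rfl)
  apply Eventually.frequently
  apply Eventually.of_forall
  intro n
  have := Real.log_nonneg (ZZ_zero_ge (f := f) hne n)
  positivity

theorem exists_unique_root (hne : (betaShift β w).Nonempty) (hc : 0 < c) (hM : 0 < M)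
    (hcM : ∀ x ∈ betaShift β w, c ≤ f x ∧ f x ≤ M) : ∃! s : ℝ, 0 ≤ s ∧ pr w f s = 0 := by
  have hp0 := pr_zero hne hc hcM
  set T := pr w f 0 / (c + 1) with hT
  have hT0 : 0 ≤ T := by positivity
  have hpT : pr w f T ≤ 0 := by
    have := pr_upper hne hc hcM le_rfl hT0
    have h2 : (T - 0) * (c + 1) = pr w f 0 := by
      rw [sub_zero, hT, div_mul_cancel₀]; linarith
    linarith
  have hcont : ContinuousOn (pr w f) (Icc 0 T) := by
    have hl : LipschitzOnWith (Real.toNNReal (M + 1)) (pr w f) (Icc 0 T) := by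
      apply LipschitzOnWith.of_dist_le_mul
      have key : ∀ x y : ℝ, 0 ≤ x → x ≤ y → |pr w f x - pr w f y| ≤ (M + 1) * |x - y| := by
        intro x y hx hxy
        have h1 := pr_upper hne hc hcM hx hxy
        have h2 := pr_lower hne hc hcM hx hxy
        have h3 : 0 ≤ (y - x) * (c + 1) := mul_nonneg (by linarith) (by linarith)
        rw [abs_of_nonneg (by linarith), abs_of_nonpos (by linarith)]
        linarith
      intro x hx y hy
      rw [Real.coe_toNNReal _ (by linarith), Real.dist_eq, Real.dist_eq]
      rcases le_total x y with h | h
      · exact key x y hx.1 h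
      · rw [abs_sub_comm, abs_sub_comm x]; exact key y x hy.1 h
    exact hl.continuousOn
  obtain ⟨s, hs, hs0⟩ := intermediate_value_Icc' hT0 hcont ⟨hpT, hp0⟩
  refine ⟨s, ⟨hs.1, hs0⟩, ?_⟩
  rintro s' ⟨hs', hs'0⟩
  by_contra hne'
  rcases lt_or_gt_of_ne hne' with h | h
  · have := pr_upper hne hc hcM hs' h.le
    have : 0 < (s - s') * (c + 1) := mul_pos (by linarith) (by linarith)
    linarith
  · have := pr_upper hne hc hcM hs.1 h.le
    have : 0 < (s' - s) * (c + 1) := mul_pos (by linarith) (by linarith)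
    linarith

/-- the covering sets -/
def UU (w : SeqSpace (Fin ⌈β⌉₊)) (f : SeqSpace (Fin ⌈β⌉₊) → ℝ) (n : ℕ)
    (v : List (Fin ⌈β⌉₊)) : Set (SeqSpace (Fin ⌈β⌉₊)) :=
  {x | x ∈ betaShift β w ∧ x ∈ cyl v ∧ dist (shift^[n] x) x ≤ Real.exp (-(birkhoff f n x))}

theorem UU_dist {n : ℕ} (hn : 0 < n) {v : List (Fin ⌈β⌉₊)} (hv : v ∈ WF β w n)
    {x y : SeqSpace (Fin ⌈β⌉₊)} (hx : x ∈ UU w f n v) (hy : y ∈ UU w f n v)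
    (hxy : birkhoff f n x ≤ birkhoff f n y) :
    dist x y ≤ Real.exp (-(birkhoff f n x + n)) := by
  obtain ⟨hxX, hxv, hxd⟩ := hx
  obtain ⟨hyX, hyv, hyd⟩ := hy
  have hl := (mem_WF.mp hv).2
  rw [cyl_iff] at hxv hyv
  have hag : ∀ i : ℕ, (i : ℝ) < birkhoff f n x + n → x i = y i := by
    intro i
    induction i using Nat.strong_induction_on with
    | _ i ih =>
      intro hi
      rcases Nat.lt_or_ge i n with h | h
      · rw [hxv i (by omega), hyv i (by omega)]
      · obtain ⟨k, rfl⟩ := Nat.exists_eq_add_of_le h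
        push_cast at hi
        have h1 := agree_of_dist_le _ _ _ hxd k (by linarith)
        have h2 := agree_of_dist_le _ _ _ hyd k (by linarith)
        rw [shift_iter] at h1 h2
        rw [h1, h2]
        apply ih k (by omega)
        have : (0 : ℝ) ≤ n := Nat.cast_nonneg _
        linarith
  refine (dist_le_of_agree x y ⌈birkhoff f n x + n⌉₊ ?_).trans ?_
  · intro i hi
    exact hag i (Nat.lt_ceil.mp hi)
  · apply Real.exp_le_exp.mpr
    have := Nat.le_ceil (birkhoff f n x + n)
    linarith

theorem UU_ediam (hc : 0 < c) (hcM : ∀ x ∈ betaShift β w, c ≤ f x ∧ f x ≤ M) {t : ℝ} (ht : 0 < t)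
    {n : ℕ} (hn : 0 < n) {v : List (Fin ⌈β⌉₊)} (hv : v ∈ WF β w n) :
    Metric.ediam (UU w f n v) ≤ ENNReal.ofReal (Real.exp (-(n : ℝ))) ∧
    Metric.ediam (UU w f n v) ^ t ≤ ENNReal.ofReal (Real.exp (SB w f t n v)) := by
  have key : ∀ x ∈ UU w f n v, ∀ y ∈ UU w f n v,
      ∃ z ∈ UU w f n v, dist x y ≤ Real.exp (-(birkhoff f n z + n)) := by
    intro x hx y hy
    rcases le_total (birkhoff f n x) (birkhoff f n y) with h | h
    · exact ⟨x, hx, UU_dist hn hv hx hy h⟩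
    · exact ⟨y, hy, by rw [dist_comm]; exact UU_dist hn hv hy hx h⟩
  constructor
  · apply Metric.ediam_le
    intro x hx y hy
    obtain ⟨z, hz, h⟩ := key x hx y hy
    rw [edist_dist]
    apply ENNReal.ofReal_le_ofReal
    refine h.trans (Real.exp_le_exp.mpr ?_)
    have h1 := (birk_bounds hcM hz.1 n).1
    have h2 : 0 ≤ c * n := by positivity
    linarith
  · have h1 : Metric.ediam (UU w f n v) ≤ ENNReal.ofReal (Real.exp (SB w f t n v / t)) := by
      apply Metric.ediam_le
      intro x hx y hy
      obtain ⟨z, hz, h⟩ := key x hx y hy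
      rw [edist_dist]
      apply ENNReal.ofReal_le_ofReal
      refine h.trans (Real.exp_le_exp.mpr ?_)
      have h1 := le_SB (n := n) hc hcM ht.le hz.1 hz.2.1
      rw [le_div_iff₀ ht]
      linarith
    refine (ENNReal.rpow_le_rpow h1 ht.le).trans ?_
    rw [ENNReal.ofReal_rpow_of_pos (Real.exp_pos _), ← Real.exp_mul, div_mul_cancel₀ _ ht.ne']

theorem upper (hne : (betaShift β w).Nonempty) (hc : 0 < c)
    (hcM : ∀ x ∈ betaShift β w, c ≤ f x ∧ f x ≤ M) {t : ℝ} (ht : 0 < t) (hpt : pr w f t < 0) :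
    dimH (recSetF (betaShift β w) f) ≤ ENNReal.ofReal t := by
  obtain ⟨ε, hε, hpε⟩ : ∃ ε : ℝ, 0 < ε ∧ pr w f t < -ε := ⟨-(pr w f t) / 2, by linarith, by linarith⟩
  have hev := eventually_lt_of_limsup_lt hpε (bdd_above_log hne hc hcM ht.le)
  obtain ⟨n0, hn0⟩ := eventually_atTop.mp hev
  have hZ : ∀ n, n0 ≤ n → 0 < n → ZZ w f t n ≤ Real.exp (-ε) ^ n := by
    intro n hn hnp
    have hnr : (0 : ℝ) < n := by exact_mod_cast hnp
    have h1 := hn0 n hn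
    rw [div_lt_iff₀ hnr, Real.log_lt_iff_lt_exp (ZZ_pos hne _ _)] at h1
    rw [← Real.exp_nat_mul, mul_comm]
    exact h1.le
  borelize (SeqSpace (Fin ⌈β⌉₊))
  have hle := Measure.hausdorffMeasure_le_liminf_tsum (β := ℕ)
    (ι := fun m => Σ k : ℕ, {v // v ∈ WF β w (m + 1 + k)}) t (recSetF (betaShift β w) f)
    (l := atTop) (fun m => ENNReal.ofReal (Real.exp (-(m : ℝ)))) (by
      rw [← ENNReal.ofReal_zero]
      apply ENNReal.tendsto_ofReal
      exact Real.tendsto_exp_neg_atTop_nhds_zero.comp tendsto_natCast_atTop_atTop)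
    (fun m i => UU w f (m + 1 + i.1) i.2.1)
    (Eventually.of_forall fun m i => (UU_ediam hc hcM ht (by omega) i.2.2).1.trans (by
      apply ENNReal.ofReal_le_ofReal
      apply Real.exp_le_exp.mpr
      apply neg_le_neg
      exact_mod_cast (by omega : m ≤ m + 1 + i.1)))
    (Eventually.of_forall fun m x hx => by
      obtain ⟨hxX, hfr⟩ := hx
      obtain ⟨n, hn, hd⟩ := frequently_atTop.mp hfr (m + 1)
      obtain ⟨k, rfl⟩ := Nat.exists_eq_add_of_le hn
      obtain ⟨h1, h2⟩ := ofFn_mem hxX (m + 1 + k)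
      exact mem_iUnion.mpr ⟨⟨k, ⟨_, h1⟩⟩, hxX, h2, hd⟩)
  set C : ℝ≥0∞ := ∑' k : ℕ, ENNReal.ofReal (Real.exp (-ε) ^ k) with hC
  have hCtop : C ≠ ∞ := by
    have hsum : Summable fun k : ℕ => Real.exp (-ε) ^ k :=
      summable_geometric_of_lt_one (Real.exp_pos _).le (by rw [Real.exp_lt_one_iff]; linarith)
    exact hsum.tsum_ofReal_ne_top
  have hlim : liminf (fun m => ∑' i : Σ k : ℕ, {v // v ∈ WF β w (m + 1 + k)},
      Metric.ediam (UU w f (m + 1 + i.1) i.2.1) ^ t) atTop ≤ C := by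
    apply liminf_le_of_frequently_le'
    apply Eventually.frequently
    filter_upwards [eventually_ge_atTop n0] with m hm
    rw [ENNReal.tsum_sigma']
    apply ENNReal.tsum_le_tsum
    intro k
    have h1 : ∑' v : {v // v ∈ WF β w (m + 1 + k)}, Metric.ediam (UU w f (m + 1 + k) v.1) ^ t ≤
        ∑' v : {v // v ∈ WF β w (m + 1 + k)},
          ENNReal.ofReal (Real.exp (SB w f t (m + 1 + k) v.1)) :=
      ENNReal.tsum_le_tsum fun v => (UU_ediam hc hcM ht (by omega) v.2).2
    refine h1.trans ?_
    rw [Finset.tsum_subtype (WF β w (m + 1 + k))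
      (fun v => ENNReal.ofReal (Real.exp (SB w f t (m + 1 + k) v))),
      ← ENNReal.ofReal_sum_of_nonneg (fun v _ => (Real.exp_pos _).le)]
    apply ENNReal.ofReal_le_ofReal
    refine (hZ (m + 1 + k) (by omega) (by omega)).trans ?_
    apply pow_le_pow_of_le_one (Real.exp_pos _).le _ (by omega)
    rw [Real.exp_le_one_iff]; linarith
  have hfin : μH[t] (recSetF (betaShift β w) f) ≠ ∞ :=
    ne_top_of_le_ne_top hCtop (hle.trans hlim)
  have := dimH_le_of_hausdorffMeasure_ne_top (d := ⟨t, ht.le⟩) (s := recSetF (betaShift β w) f) hfin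
  refine this.trans (le_of_eq ?_)
  rw [ENNReal.ofReal, Real.toNNReal_of_nonneg ht.le]
  rfl

end press

end BetaRec

namespace BetaRec

section lower
variable {β : ℝ} {w : SeqSpace (Fin ⌈β⌉₊)} {f : SeqSpace (Fin ⌈β⌉₊) → ℝ}

/-- editing a point of the `β`-shift into a freely concatenable block -/
theorem edit (hw0 : 0 < (w 0 : ℕ)) {x : SeqSpace (Fin ⌈β⌉₊)} (hx : x ∈ betaShift β w) {N : ℕ}
    (hN : 0 < N) : ∃ (y : ℕ → Fin ⌈β⌉₊) (p : ℕ), p < N ∧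
      (∀ i < N, i ≠ 0 → i ≠ p → y i = x i) ∧
      (∀ i < N, ∃ p < N, i ≤ p ∧ (∀ l, i ≤ l → l < p → y l = w (l - i)) ∧ y p < w (p - i)) := by
  classical
  have hb : 0 < ⌈β⌉₊ := (w 0).pos
  let z : ℕ → Fin ⌈β⌉₊ := fun i => if i = 0 then ⟨0, hb⟩ else x i
  have hz0 : z 0 = ⟨0, hb⟩ := by simp [z]
  have hzi : ∀ i, i ≠ 0 → z i = x i := fun i hi => by simp [z, hi]
  have hwz : (⟨0, hb⟩ : Fin ⌈β⌉₊) < w 0 := hw0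
  by_cases hall : ∀ i < N, z i = ⟨0, hb⟩
  · refine ⟨z, 0, hN, fun i _ h0 _ => hzi i h0, ?_⟩
    intro i hi
    refine ⟨i, hi, le_rfl, fun l h1 h2 => by omega, ?_⟩
    rw [hall i hi, Nat.sub_self]
    exact hwz
  · push Not at hall
    obtain ⟨p, ⟨hpN, hpz⟩, hpmax⟩ : ∃ p, (p < N ∧ z p ≠ ⟨0, hb⟩) ∧
        ∀ i, p < i → i < N → z i = ⟨0, hb⟩ := by
      obtain ⟨q, hq, hqz⟩ := hall
      have hne : ((Finset.range N).filter fun i => z i ≠ ⟨0, hb⟩).Nonempty :=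
        ⟨q, by simp [hq, hqz]⟩
      refine ⟨_, by
        simpa only [Finset.mem_filter, Finset.mem_range] using Finset.max'_mem _ hne, ?_⟩
      intro i hi hiN
      by_contra hc
      have := Finset.le_max' ((Finset.range N).filter fun i => z i ≠ ⟨0, hb⟩) i
        (by simp [hiN, hc])
      omega
    have hp0 : p ≠ 0 := by rintro rfl; exact hpz hz0
    have hpx : 0 < (x p : ℕ) := by
      rw [hzi p hp0] at hpz
      rw [Nat.pos_iff_ne_zero]
      intro h
      exact hpz (Fin.ext h)
    let y : ℕ → Fin ⌈β⌉₊ := fun i => if i = p then ⟨(x p : ℕ) - 1, by have := (x p).2; omega⟩ else z i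
    have hyp : y p < x p := by
      rw [Fin.lt_def]; simp [y]; omega
    have hyi : ∀ i, i ≠ p → y i = z i := fun i hi => by simp [y, hi]
    refine ⟨y, p, hpN, fun i _ h0 hp => by rw [hyi i hp, hzi i h0], ?_⟩
    intro i hi
    have hzero : y i = ⟨0, hb⟩ → ∃ p < N, i ≤ p ∧ (∀ l, i ≤ l → l < p → y l = w (l - i)) ∧
        y p < w (p - i) := fun h =>
      ⟨i, hi, le_rfl, fun l h1 h2 => by omega, by rw [h, Nat.sub_self]; exact hwz⟩
    by_cases hi0 : i = 0
    · subst hi0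
      exact hzero (by rw [hyi 0 (Ne.symm hp0), hz0])
    by_cases hip : p < i
    · exact hzero (by rw [hyi i (by omega), hpmax i hip hi])
    push Not at hip
    have hyx : ∀ l, i ≤ l → l < p → y l = x l := fun l h1 h2 => by
      rw [hyi l (by omega), hzi l (by omega)]
    have hlex := hx i (by omega)
    rcases hlex with h | ⟨n, h1, h2⟩
    · have h' : ∀ l, i ≤ l → x l = w (l - i) := fun l hl => by
        rw [← h, shift_iter]; congr 1; omega
      exact ⟨p, hpN, hip, fun l a b => by rw [hyx l a b, h' l a], by rw [← h' p hip]; exact hyp⟩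
    · have h' : ∀ l, i ≤ l → l < i + n → x l = w (l - i) := fun l hl hl2 => by
        rw [← h1 (l - i) (by omega), shift_iter]; congr 1; omega
      rw [shift_iter] at h2
      by_cases hn : i + n < p
      · refine ⟨i + n, by omega, by omega, fun l a b => ?_, ?_⟩
        · rw [hyx l a (by omega), h' l a b]
        · rw [hyx _ (by omega) hn, Nat.add_sub_cancel_left]; exact h2
      · refine ⟨p, hpN, hip, fun l a b => by rw [hyx l a b, h' l a (by omega)], ?_⟩
        refine lt_of_lt_of_le hyp ?_
        by_cases hpe : p = i + n
        · rw [hpe, Nat.add_sub_cancel_left]; exact h2.le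
        · exact (h' p hip (by omega)).le

variable {c M : ℝ}

/-- distortion -/
theorem distortion (hc : 0 < c) (hM : 0 < M) (hcM : ∀ x ∈ betaShift β w, c ≤ f x ∧ f x ≤ M)
    {ε : ℝ} (hε : 0 < ε) {m : ℕ} (hm : ∀ x ∈ betaShift β w, ∀ y ∈ betaShift β w,
      (∀ i < m, x i = y i) → |f x - f y| ≤ ε) {N p : ℕ} {x y : SeqSpace (Fin ⌈β⌉₊)}
    (hx : x ∈ betaShift β w) (hy : y ∈ betaShift β w)
    (hxy : ∀ i < N, i ≠ 0 → i ≠ p → y i = x i) :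
    birkhoff f N y ≤ birkhoff f N x + (N * ε + (1 + 2 * m) * M) := by
  classical
  let Bad : Finset ℕ := {0} ∪ (Finset.Ico (p + 1 - m) (p + 1) ∪ Finset.Ico (N - m) N)
  have hcard : (Bad.card : ℝ) ≤ 1 + 2 * m := by
    have h1 : Bad.card ≤ 1 + (m + m) := by
      refine (Finset.card_union_le _ _).trans (add_le_add (by simp) ?_)
      refine (Finset.card_union_le _ _).trans (add_le_add ?_ ?_)
      · rw [Nat.card_Ico]; omega
      · rw [Nat.card_Ico]; omega
    have : (Bad.card : ℝ) ≤ ((1 + (m + m) : ℕ) : ℝ) := by exact_mod_cast h1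
    push_cast at this
    linarith
  have hterm : ∀ k ∈ Finset.range N, f (shift^[k] y) ≤ f (shift^[k] x) + ε +
      (if k ∈ Bad then M else 0) := by
    intro k hk
    have hk := Finset.mem_range.mp hk
    have hbx := hcM _ (shift_mem hx k)
    have hby := hcM _ (shift_mem hy k)
    split_ifs with hB
    · linarith
    · simp only [Bad, Finset.mem_union, Finset.mem_singleton, Finset.mem_Ico, not_or] at hB
      have := hm _ (shift_mem hx k) _ (shift_mem hy k) (fun i hi => by
        rw [shift_iter, shift_iter]
        exact (hxy (k + i) (by omega) (by omega) (by omega)).symm)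
      have := (abs_le.mp this).1
      linarith
  unfold birkhoff
  refine (Finset.sum_le_sum hterm).trans ?_
  rw [Finset.sum_add_distrib, Finset.sum_add_distrib]
  have h2 : ∑ k ∈ Finset.range N, (if k ∈ Bad then M else 0) ≤ (1 + 2 * m) * M := by
    rw [← Finset.sum_filter, Finset.sum_const, nsmul_eq_mul]
    have h3 : ((Finset.range N).filter (· ∈ Bad)).card ≤ Bad.card :=
      Finset.card_le_card fun a ha => (Finset.mem_filter.mp ha).2
    have h4 : (((Finset.range N).filter (· ∈ Bad)).card : ℝ) ≤ Bad.card := by exact_mod_cast h3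
    exact mul_le_mul_of_nonneg_right (h4.trans hcard) hM.le
  simp only [Finset.sum_const, Finset.card_range, nsmul_eq_mul]
  linarith

theorem exp_beats (C : ℝ) {δ : ℝ} (hδ : 0 < δ) :
    ∀ᶠ N : ℕ in atTop, C * (N : ℝ) ^ 2 ≤ Real.exp (N * δ) := by
  obtain ⟨N0, hN0⟩ := exists_nat_ge (6 * C / δ ^ 3)
  filter_upwards [eventually_ge_atTop N0] with N hN
  have h1 : 6 * C / δ ^ 3 ≤ N := hN0.trans (by exact_mod_cast hN)
  rw [div_le_iff₀ (by positivity)] at h1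
  have h2 := Real.pow_div_factorial_le_exp (x := N * δ) (by positivity) 3
  refine le_trans ?_ h2
  rw [show (Nat.factorial 3 : ℝ) = 6 by norm_num [Nat.factorial], le_div_iff₀ (by norm_num)]
  have := mul_le_mul_of_nonneg_right h1 (sq_nonneg (N : ℝ))
  nlinarith

theorem lower_bd (hw0 : 0 < (w 0 : ℕ)) (hne : (betaShift β w).Nonempty)
    (hfc : ContinuousOn f (betaShift β w)) (hc : 0 < c) (hM : 0 < M)
    (hcM : ∀ x ∈ betaShift β w, c ≤ f x ∧ f x ≤ M) {t η : ℝ} (ht : 0 < t) (hη : 0 < η)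
    (hη1 : η < 1) (hpt : 0 < pr w f t) :
    ENNReal.ofReal (t * (1 - η)) ≤ dimH (recSetF (betaShift β w) f) := by
  classical
  obtain ⟨δ, hδ, hδp⟩ : ∃ δ : ℝ, 0 < δ ∧ 4 * δ < pr w f t := ⟨pr w f t / 8, by linarith, by linarith⟩
  have hfreq := frequently_lt_of_lt_limsup (bdd_below_log hne hc hcM ht.le).isCoboundedUnder_le hδp
  have hε : 0 < δ / t := by positivity
  obtain ⟨m, hm⟩ := unif hfc hε
  set K : ℝ := (1 + 2 * m) * M with hK
  have hK0 : 0 < K := by positivity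
  set B : ℝ := (⌈β⌉₊ : ℝ) with hB
  have hB1 : (0 : ℝ) < B := by rw [hB]; exact_mod_cast (w 0).pos
  obtain ⟨N, hNlog, hNexp, hN⟩ := (hfreq.and_eventually
    ((exp_beats ((M + 1) * B ^ 2 * Real.exp (t * (2 * K + 2))) (δ := 2 * δ) (by linarith)).and
      (eventually_gt_atTop 0))).exists
  have hNr : (0 : ℝ) < N := by exact_mod_cast hN
  have hN1 : (1 : ℝ) ≤ N := by exact_mod_cast hN
  have hZ : Real.exp (4 * δ * N) ≤ ZZ w f t N := by
    rw [lt_div_iff₀ hNr, Real.lt_log_iff_exp_lt (ZZ_pos hne _ _)] at hNlog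
    exact hNlog.le
  -- choose points and edits
  have hch : ∀ v : List (Fin ⌈β⌉₊), ∃ x : SeqSpace (Fin ⌈β⌉₊), v ∈ WF β w N →
      x ∈ betaShift β w ∧ x ∈ cyl v := by
    intro v
    by_cases hv : v ∈ WF β w N
    · obtain ⟨x, h⟩ := cyl_nonempty hv
      exact ⟨x, fun _ => h⟩
    · exact ⟨w, fun h => absurd h hv⟩
  choose pt hpt' using hch
  have hch2 : ∀ v : List (Fin ⌈β⌉₊), ∃ (y : ℕ → Fin ⌈β⌉₊) (p : ℕ), v ∈ WF β w N → p < N ∧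
      (∀ i < N, i ≠ 0 → i ≠ p → y i = pt v i) ∧
      (∀ i < N, ∃ p < N, i ≤ p ∧ (∀ l, i ≤ l → l < p → y l = w (l - i)) ∧ y p < w (p - i)) := by
    intro v
    by_cases hv : v ∈ WF β w N
    · obtain ⟨y, p, h⟩ := edit hw0 (hpt' v hv).1 hN
      exact ⟨y, p, fun _ => h⟩
    · exact ⟨w, 0, fun h => absurd h hv⟩
  choose bl pos hbl using hch2
  have hSB : ∀ v ∈ WF β w N, SB w f t N v ≤
      -(t * (birkhoff f N (pt v) + N)) + (N * δ + t * K) := by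
    intro v hv
    apply SB_le hv
    intro x hx hxv
    have hd := distortion (p := 0) hc hM hcM hε hm hx (hpt' v hv).1 (N := N) (fun i hi _ _ => by
      have hl := (mem_WF.mp hv).2
      rw [(cyl_iff _ _).mp hxv i (by omega), (cyl_iff _ _).mp (hpt' v hv).2 i (by omega)])
    have h2 := mul_le_mul_of_nonneg_left hd ht.le
    have h3 : t * (birkhoff f N x + (N * (δ / t) + K)) = t * birkhoff f N x + N * δ + t * K := by
      field_simp
      ring
    rw [h3] at h2
    linarith
  let κ : List (Fin ⌈β⌉₊) → ℕ × Fin ⌈β⌉₊ × ℕ × Fin ⌈β⌉₊ := fun v =>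
    (⌊birkhoff f N (pt v)⌋₊, pt v 0, pos v, pt v (pos v))
  let T : Finset (ℕ × Fin ⌈β⌉₊ × ℕ × Fin ⌈β⌉₊) :=
    Finset.range (⌊M * N⌋₊ + 1) ×ˢ (Finset.univ ×ˢ (Finset.range N ×ˢ Finset.univ))
  have hκ : ∀ v ∈ WF β w N, κ v ∈ T := by
    intro v hv
    simp only [κ, T, Finset.mem_product, Finset.mem_range, Finset.mem_univ, true_and, and_true]
    refine ⟨?_, (hbl v hv).1⟩
    exact Nat.lt_succ_of_le (Nat.floor_le_floor (birk_bounds hcM (hpt' v hv).1 N).2)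
  have hTne : T.Nonempty := by
    obtain ⟨x, hx⟩ := hne
    exact ⟨_, hκ _ (ofFn_mem hx N).1⟩
  have hTcard : (T.card : ℝ) ≤ (M + 1) * B ^ 2 * N ^ 2 := by
    simp only [T, Finset.card_product, Finset.card_range, Finset.card_univ, Fintype.card_fin]
    push_cast
    rw [← hB]
    have h1 : (⌊M * N⌋₊ : ℝ) + 1 ≤ (M + 1) * N := by
      have := Nat.floor_le (show 0 ≤ M * N by positivity)
      linarith
    calc ((⌊M * N⌋₊ : ℝ) + 1) * (B * (N * B)) ≤ ((M + 1) * N) * (B * (N * B)) :=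
          mul_le_mul_of_nonneg_right h1 (by positivity)
      _ = _ := by ring
  have hTpos : (0 : ℝ) < T.card := by exact_mod_cast hTne.card_pos
  obtain ⟨κ0, hκ0, hbig⟩ := Finset.exists_le_sum_fiber_of_maps_to_of_nsmul_le_sum
    (b := Real.exp (4 * δ * N) / T.card) hκ hTne (w := fun v => Real.exp (SB w f t N v)) (by
      rw [nsmul_eq_mul, mul_div_cancel₀ _ hTpos.ne']
      exact hZ)
  set cls := (WF β w N).filter fun v => κ v = κ0 with hcls
  set c0 := κ0.1 with hc0
  set j : ℕ := c0 + 1 + ⌈N * (δ / t) + K⌉₊ with hj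
  have hmem : ∀ v ∈ cls, v ∈ WF β w N ∧ κ v = κ0 := fun v hv => Finset.mem_filter.mp hv
  have hfl : ∀ v ∈ cls, (c0 : ℝ) ≤ birkhoff f N (pt v) ∧ birkhoff f N (pt v) < c0 + 1 := by
    intro v hv
    obtain ⟨h1, h2⟩ := hmem v hv
    have h3 : ⌊birkhoff f N (pt v)⌋₊ = c0 := by rw [hc0, ← h2]
    have h0 : 0 ≤ birkhoff f N (pt v) :=
      le_trans (by positivity) (birk_bounds hcM (hpt' v h1).1 N).1
    rw [← h3]
    exact ⟨Nat.floor_le h0, Nat.lt_floor_add_one _⟩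
  have hsum : ∑ v ∈ cls, Real.exp (SB w f t N v) ≤
      cls.card * Real.exp (-(t * (c0 + N)) + (N * δ + t * K)) := by
    rw [← nsmul_eq_mul]
    apply Finset.sum_le_card_nsmul
    intro v hv
    apply Real.exp_le_exp.mpr
    refine (hSB v (hmem v hv).1).trans ?_
    have := mul_le_mul_of_nonneg_left (hfl v hv).1 ht.le
    linarith
  have hjr : (j : ℝ) ≤ c0 + 2 + (N * (δ / t) + K) := by
    have := Nat.ceil_lt_add_one (show 0 ≤ N * (δ / t) + K by positivity)
    rw [hj]; push_cast; linarith
  have hbt : Real.exp (t * (N + j)) ≤ cls.card := by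
    have h1 := hbig.trans hsum
    rw [div_le_iff₀ hTpos] at h1
    have h2 : (T.card : ℝ) * Real.exp (t * (2 * K + 2)) ≤ Real.exp (N * (2 * δ)) := by
      refine le_trans (mul_le_mul_of_nonneg_right hTcard (Real.exp_pos _).le) ?_
      refine le_trans (le_of_eq ?_) hNexp
      ring
    have h3 : t * (N + j) ≤ t * (N + c0) + N * δ + t * K + 2 * t := by
      have := mul_le_mul_of_nonneg_left hjr ht.le
      have h4 : t * (c0 + 2 + (N * (δ / t) + K)) = t * c0 + 2 * t + N * δ + t * K := by
        field_simp
        ring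
      rw [h4] at this
      linarith
    have h5 : Real.exp (4 * δ * N) * Real.exp (t * (2 * K + 2)) ≤
        cls.card * Real.exp (-(t * (c0 + N)) + (N * δ + t * K)) * Real.exp (N * (2 * δ)) := by
      calc _ ≤ cls.card * Real.exp (-(t * (c0 + N)) + (N * δ + t * K)) * T.card *
            Real.exp (t * (2 * K + 2)) := mul_le_mul_of_nonneg_right h1 (Real.exp_pos _).le
        _ = cls.card * Real.exp (-(t * (c0 + N)) + (N * δ + t * K)) *
            (T.card * Real.exp (t * (2 * K + 2))) := by ring
        _ ≤ _ := mul_le_mul_of_nonneg_left h2 (by positivity)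
    rw [mul_assoc (cls.card : ℝ), ← Real.exp_add, ← Real.exp_add] at h5
    have h6 := mul_le_mul_of_nonneg_right h5
      (Real.exp_pos (-(-(t * (c0 + N)) + (N * δ + t * K) + N * (2 * δ)))).le
    rw [mul_assoc (cls.card : ℝ), ← Real.exp_add, ← Real.exp_add, add_neg_cancel, Real.exp_zero, mul_one] at h6
    refine le_trans (Real.exp_le_exp.mpr ?_) h6
    linarith
  have hb : 1 < cls.card := by
    have h1 : 1 < Real.exp (t * (N + j)) := by
      rw [Real.one_lt_exp_iff]; positivity
    exact_mod_cast h1.trans_le hbt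
  let en := cls.equivFin.symm
  refine core (N := N) (j := j) (b := cls.card) hN hb (fun e => bl (en e).1) ?_ ?_ ?_ ht hη hη1 hbt
  · intro e e' h
    apply en.injective
    apply Subtype.ext
    obtain ⟨h1, h2⟩ := hmem _ (en e).2
    obtain ⟨h1', h2'⟩ := hmem _ (en e').2
    have hk : κ (en e).1 = κ (en e').1 := h2.trans h2'.symm
    simp only [κ, Prod.mk.injEq] at hk
    obtain ⟨-, ka, kb, kc⟩ := hk
    have hlen := (mem_WF.mp h1).2
    have hlen' := (mem_WF.mp h1').2
    apply List.ext_getElem (by rw [hlen, hlen'])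
    intro i hi hi'
    rw [← (cyl_iff _ _).mp (hpt' _ h1).2 i hi, ← (cyl_iff _ _).mp (hpt' _ h1').2 i hi']
    by_cases hi0 : i = 0
    · rw [hi0]; exact ka
    by_cases hip : i = pos (en e).1
    · rw [hip, kc, ← kb]
    have hiN : i < N := by omega
    rw [← (hbl _ h1).2.1 i hiN hi0 hip, ← (hbl _ h1').2.1 i hiN hi0 (by rw [← kb]; exact hip)]
    exact h i hiN
  · intro e
    exact (hbl _ (hmem _ (en e).2).1).2.2
  · intro e x hx hxe
    obtain ⟨h1, h2⟩ := hmem _ (en e).2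
    have hd := distortion (p := pos (en e).1) hc hM hcM hε hm (hpt' _ h1).1 hx (N := N)
      (fun i hi h0 hp => by rw [hxe i hi]; exact (hbl _ h1).2.1 i hi h0 hp)
    have := (hfl _ (en e).2).2
    have h4 := Nat.le_ceil (N * (δ / t) + K)
    rw [hj]; push_cast
    linarith

end lower

end BetaRec

/-- **Application to β-shifts.** Let `β > 1`, let `w` be the greedy `β`-expansion of 1
and `Σ_β` the `β`-shift. For any continuous positive `f : Σ_β → (0,∞)`, `dim_H R(f)` is
the unique solution `s ≥ 0` of the pressure equation `P(-s(f+1)) = 0`. -/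
theorem dimH_recSetF_betaShift
    (β : ℝ) (hβ : 1 < β) (w : SeqSpace (Fin ⌈β⌉₊))
    (hw1 : ∑' j : ℕ, ((w j : ℕ) : ℝ) / β ^ (j + 1) = 1)
    (hwmax : ∀ v : SeqSpace (Fin ⌈β⌉₊),
      (∑' j : ℕ, ((v j : ℕ) : ℝ) / β ^ (j + 1)) = 1 → LexLe v w)
    (f : SeqSpace (Fin ⌈β⌉₊) → ℝ) (hfc : ContinuousOn f (betaShift β w))
    (hfpos : ∀ x ∈ betaShift β w, 0 < f x) :
    (∃! s : ℝ, 0 ≤ s ∧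
      pressure (betaShift β w) (language (betaShift β w))
        (fun x => -(s * (f x + 1))) = 0) ∧
    ∀ s : ℝ, 0 ≤ s →
      pressure (betaShift β w) (language (betaShift β w))
        (fun x => -(s * (f x + 1))) = 0 →
      dimH (recSetF (betaShift β w) f) = ENNReal.ofReal s := by
  have hw0 : 0 < (w 0 : ℕ) := BetaRec.w_pos hβ hwmax
  have hne : (betaShift β w).Nonempty := by
    let z : SeqSpace (Fin ⌈β⌉₊) := fun _ => ⟨0, (w 0).pos⟩
    refine ⟨z, ?_⟩
    intro j _
    refine Or.inr ⟨0, fun i hi => absurd hi (Nat.not_lt_zero i), ?_⟩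
    have h : (shift^[j] z) 0 = z (j + 0) := BetaRec.shift_iter z j 0
    rw [h]
    exact hw0
  obtain ⟨c, M, hc, hM, hcM⟩ := BetaRec.bounds hfc hfpos
  simp only [BetaRec.pressure_eq]
  refine ⟨BetaRec.exists_unique_root hne hc hM hcM, ?_⟩
  intro s hs hps
  apply le_antisymm
  · apply ENNReal.le_of_forall_pos_le_add
    intro ε hε _
    have hεr : (0 : ℝ) < ε := by exact_mod_cast hε
    have hp := BetaRec.pr_upper hne hc hcM hs (show s ≤ s + ε by linarith)
    have h1 : 0 < (s + ε - s) * (c + 1) := by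
      rw [add_sub_cancel_left]; positivity
    have := BetaRec.upper hne hc hcM (t := s + ε) (by linarith) (by linarith)
    rwa [ENNReal.ofReal_add hs hεr.le, ENNReal.ofReal_coe_nnreal] at this
  · apply le_of_forall_lt
    intro r hr
    have hrtop : r ≠ ⊤ := ne_top_of_lt hr
    lift r to ℝ≥0 using hrtop
    have hrs : (r : ℝ) < s := by
      rw [ENNReal.ofReal, ENNReal.coe_lt_coe, Real.lt_toNNReal_iff_coe_lt] at hr
      exact hr
    have hr0 : (0 : ℝ) ≤ r := r.2
    -- t strictly between, and t * (1 - η) > r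
    set t : ℝ := (r + 2 * s) / 3 with ht
    have ht0 : 0 < t := by rw [ht]; linarith
    have hts : t < s := by rw [ht]; linarith
    have hp := BetaRec.pr_upper hne hc hcM ht0.le hts.le
    have h1 : 0 < (s - t) * (c + 1) := mul_pos (by linarith) (by linarith)
    have hrt : (r : ℝ) < t := by rw [ht]; linarith
    set η : ℝ := (t - r) / (2 * t) with hη
    have hη0 : 0 < η := div_pos (by linarith) (by linarith)
    have hη1 : η < 1 := by rw [hη, div_lt_one (by linarith)]; linarith
    have hb := BetaRec.lower_bd hw0 hne hfc hc hM hcM ht0 hη0 hη1 (by linarith)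
    refine lt_of_lt_of_le ?_ hb
    have h2 : t * (1 - η) = (t + r) / 2 := by
      rw [hη]; field_simp; ring
    rw [h2, ENNReal.ofReal, ENNReal.coe_lt_coe, Real.lt_toNNReal_iff_coe_lt]
    linarith
end
end

section
/- Let S ⊆ {0,1,2,…} be infinite and let Σ_S be the S-gap shift, with shift map σ and the metric d(u,v) = e^{-|u∧v|}. Let f : Σ_S → (0,∞) be a continuous positive function. Then the Hausdorff dimension of R(f) = {x ∈ Σ_S : d(σ^n x, x) ≤ e^{-S_n f(x)} for infinitely many n} is the unique solution s ≥ 0 of the pressure equation P(−s(f+1)) = 0. -/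
open Filter MeasureTheory Set
open scoped ENNReal NNReal

noncomputable section

open SeqSpace

/-- The S-gap shift: all binary sequences in which the number of `0`s between any two
consecutive occurrences of `1` lies in `S`. -/
def sGapShift (S : Set ℕ) : Set (SeqSpace (Fin 2)) :=
  {x | ∀ i j : ℕ, i < j → x i = 1 → x j = 1 →
    (∀ k, i < k → k < j → x k = 0) → (j - i - 1) ∈ S}

/-! ### Basic facts on the sequence space -/

theorem dist_eq_exp {x y : SeqSpace (Fin 2)} (h : x ≠ y) :
    dist x y = Real.exp (-(lcp x y : ℝ)) := by
  change sdist x y = _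
  rw [sdist, if_neg h]

theorem eq_of_lt_lcp {x y : SeqSpace (Fin 2)} {i : ℕ} (h : i < lcp x y) : x i = y i := by
  by_contra hne
  have : lcp x y ≤ i := Nat.sInf_le hne
  omega

theorem dist_le_of_agree {x y : SeqSpace (Fin 2)} {n : ℕ} (h : ∀ i < n, x i = y i) :
    dist x y ≤ Real.exp (-(n : ℝ)) := by
  by_cases hxy : x = y
  · rw [hxy, dist_self]; exact (Real.exp_pos _).le
  rw [dist_eq_exp hxy]
  apply Real.exp_le_exp.mpr
  have : n ≤ lcp x y := by
    by_contra hlt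
    push Not at hlt
    exact lcp_mem hxy (h _ hlt)
  have : (n : ℝ) ≤ lcp x y := by exact_mod_cast this
  linarith

theorem agree_of_dist_le {x y : SeqSpace (Fin 2)} {r : ℝ} (h : dist x y ≤ Real.exp (-r))
    {i : ℕ} (hi : (i : ℝ) < r) : x i = y i := by
  by_cases hxy : x = y
  · rw [hxy]
  rw [dist_eq_exp hxy, Real.exp_le_exp] at h
  apply eq_of_lt_lcp
  have : (i : ℝ) < lcp x y := by linarith
  exact_mod_cast this

theorem shift_iterate_apply (n : ℕ) (x : SeqSpace (Fin 2)) (i : ℕ) :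
    (shift^[n] x) i = x (n + i) := by
  induction n generalizing x with
  | zero => simp
  | succ n ih =>
    rw [Function.iterate_succ_apply, ih]
    change x (n + i + 1) = _
    congr 1; omega

theorem shift_iterate_mem {S : Set ℕ} {x : SeqSpace (Fin 2)} (hx : x ∈ sGapShift S) (n : ℕ) :
    shift^[n] x ∈ sGapShift S := by
  intro i j hij hi hj hk
  rw [shift_iterate_apply] at hi hj
  have := hx (n + i) (n + j) (by omega) hi hj (fun k h1 h2 => by
    have := hk (k - n) (by omega) (by omega)
    rw [shift_iterate_apply] at this
    rwa [show n + (k - n) = k by omega] at this)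
  rwa [show n + j - (n + i) - 1 = j - i - 1 by omega] at this

theorem zero_mem_sGapShift (S : Set ℕ) : (fun _ => 0 : SeqSpace (Fin 2)) ∈ sGapShift S := by
  intro i j hij hi
  simp at hi

/-- The identity from the product space. -/
def ofPi (x : ℕ → Fin 2) : SeqSpace (Fin 2) := x

theorem continuous_ofPi : Continuous ofPi := by
  rw [continuous_iff_continuousAt]
  intro x
  rw [ContinuousAt, Metric.tendsto_nhds]
  intro ε hε
  obtain ⟨n, hn⟩ : ∃ n : ℕ, Real.exp (-(n : ℝ)) < ε := by
    have : Tendsto (fun n : ℕ => Real.exp (-(n : ℝ))) atTop (nhds 0) :=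
      Real.tendsto_exp_neg_atTop_nhds_zero.comp tendsto_natCast_atTop_atTop
    exact (this.eventually (gt_mem_nhds hε)).exists
  have hev : ∀ i ∈ Finset.range n, ∀ᶠ y : ℕ → Fin 2 in nhds x, y i = x i := by
    intro i _
    have : Tendsto (fun y : ℕ → Fin 2 => y i) (nhds x) (nhds (x i)) :=
      (continuous_apply i).tendsto x
    exact this.eventually ((isOpen_discrete {x i}).mem_nhds rfl)
  have := (Filter.eventually_all_finset (Finset.range n)).mpr hev
  filter_upwards [this] with y hy
  refine lt_of_le_of_lt (dist_le_of_agree (n := n) ?_) hn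
  intro i hi
  exact hy i (Finset.mem_range.mpr hi)

theorem isClosed_sGapShift (S : Set ℕ) :
    IsClosed {x : ℕ → Fin 2 | ofPi x ∈ sGapShift S} := by
  have : {x : ℕ → Fin 2 | ofPi x ∈ sGapShift S} =
      ⋂ i, ⋂ j, {x : ℕ → Fin 2 | i < j → x i = 1 → x j = 1 →
        (∀ k, i < k → k < j → x k = 0) → (j - i - 1) ∈ S} := by
    ext x
    simp only [mem_iInter]
    exact Iff.rfl
  rw [this]
  refine isClosed_iInter fun i => isClosed_iInter fun j => ?_
  have hfac : {x : ℕ → Fin 2 | i < j → x i = 1 → x j = 1 →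
        (∀ k, i < k → k < j → x k = 0) → (j - i - 1) ∈ S} =
      (fun (x : ℕ → Fin 2) (k : Fin (i + j + 1)) => x k) ⁻¹'
        {z : Fin (i + j + 1) → Fin 2 | i < j → z ⟨i, by omega⟩ = 1 → z ⟨j, by omega⟩ = 1 →
          (∀ k : Fin (i + j + 1), i < k → k < j → z k = 0) → (j - i - 1) ∈ S} := by
    ext x
    simp only [mem_ofPred_eq, mem_preimage]
    constructor
    · intro h h1 h2 h3 h4
      exact h h1 h2 h3 (fun k hk hk' => h4 ⟨k, by omega⟩ hk hk')
    · intro h h1 h2 h3 h4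
      exact h h1 h2 h3 (fun k hk hk' => h4 k hk hk')
  rw [hfac]
  exact (isClosed_discrete _).preimage (by fun_prop)

theorem isCompact_sGapShift (S : Set ℕ) : IsCompact (sGapShift S) := by
  have h := (isClosed_sGapShift S).isCompact.image continuous_ofPi
  convert h using 1
  ext x
  constructor
  · intro hx
    exact ⟨x, hx, rfl⟩
  · rintro ⟨y, hy, rfl⟩
    exact hy

/-- An upper bound for `f`. -/
theorem exists_bound {S : Set ℕ} {f : SeqSpace (Fin 2) → ℝ}
    (hfc : ContinuousOn f (sGapShift S)) :
    ∃ F : ℝ, 0 ≤ F ∧ ∀ x ∈ sGapShift S, f x ≤ F := by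
  obtain ⟨C, hC⟩ := (isCompact_sGapShift S).exists_bound_of_continuousOn hfc
  refine ⟨max C 0, le_max_right _ _, fun x hx => ?_⟩
  exact (le_abs_self _).trans ((hC x hx).trans (le_max_left _ _))

/-- Uniform continuity of `f`. -/
theorem exists_window {S : Set ℕ} {f : SeqSpace (Fin 2) → ℝ}
    (hfc : ContinuousOn f (sGapShift S)) {ε : ℝ} (hε : 0 < ε) :
    ∃ m : ℕ, ∀ x ∈ sGapShift S, ∀ y ∈ sGapShift S, (∀ i < m, x i = y i) → f x ≤ f y + ε := by
  have hu := (isCompact_sGapShift S).uniformContinuousOn_of_continuous hfc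
  rw [Metric.uniformContinuousOn_iff] at hu
  obtain ⟨δ, hδ, h⟩ := hu ε hε
  obtain ⟨n, hn⟩ : ∃ n : ℕ, Real.exp (-(n : ℝ)) < δ := by
    have : Tendsto (fun n : ℕ => Real.exp (-(n : ℝ))) atTop (nhds 0) :=
      Real.tendsto_exp_neg_atTop_nhds_zero.comp tendsto_natCast_atTop_atTop
    exact (this.eventually (gt_mem_nhds hδ)).exists
  refine ⟨n, fun x hx y hy hxy => ?_⟩
  have := h x hx y hy (lt_of_le_of_lt (dist_le_of_agree hxy) hn)
  rw [Real.dist_eq] at this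
  linarith [(abs_lt.mp this).2]

theorem birkhoff_nonneg {S : Set ℕ} {f : SeqSpace (Fin 2) → ℝ}
    (hfpos : ∀ x ∈ sGapShift S, 0 < f x) (n : ℕ) {x : SeqSpace (Fin 2)}
    (hx : x ∈ sGapShift S) : 0 ≤ birkhoff f n x :=
  Finset.sum_nonneg fun k _ => (hfpos _ (shift_iterate_mem hx k)).le

theorem birkhoff_le {S : Set ℕ} {f : SeqSpace (Fin 2) → ℝ} {F : ℝ}
    (hF : ∀ x ∈ sGapShift S, f x ≤ F) (n : ℕ) {x : SeqSpace (Fin 2)}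
    (hx : x ∈ sGapShift S) : birkhoff f n x ≤ n * F := by
  have := Finset.sum_le_card_nsmul (Finset.range n) (fun k => f (shift^[k] x)) F
    (fun k _ => hF _ (shift_iterate_mem hx k))
  simpa [birkhoff] using this

theorem birkhoff_pot (f : SeqSpace (Fin 2) → ℝ) (s : ℝ) (n : ℕ) (x : SeqSpace (Fin 2)) :
    birkhoff (fun x => -(s * (f x + 1))) n x = -(s * (birkhoff f n x + n)) := by
  simp [birkhoff, Finset.sum_neg_distrib, ← Finset.mul_sum, Finset.sum_add_distrib]

theorem birkhoff_add (f : SeqSpace (Fin 2) → ℝ) (m n : ℕ) (x : SeqSpace (Fin 2)) :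
    birkhoff f (m + n) x = birkhoff f m x + birkhoff f n (shift^[m] x) := by
  simp only [birkhoff, Finset.sum_range_add]
  congr 1
  apply Finset.sum_congr rfl
  intro k _
  rw [← Function.iterate_add_apply, add_comm]

/-! ### Partition sums and pressure -/

theorem finite_wordsOfLen (S : Set ℕ) (n : ℕ) :
    (wordsOfLen (language (sGapShift S)) n).Finite :=
  (List.finite_length_eq (Fin 2) n).subset fun _ hw => hw.2

/-- The finite set of words of length `n` of the language. -/
def gapWords (S : Set ℕ) (n : ℕ) : Finset (List (Fin 2)) := (finite_wordsOfLen S n).toFinset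

theorem length_of_mem_gapWords {S : Set ℕ} {n : ℕ} {w : List (Fin 2)} (hw : w ∈ gapWords S n) :
    w.length = n := by
  have : w ∈ wordsOfLen (language (sGapShift S)) n := by simpa [gapWords] using hw
  exact this.2

theorem nonempty_of_mem_gapWords {S : Set ℕ} {n : ℕ} {w : List (Fin 2)} (hw : w ∈ gapWords S n) :
    (sGapShift S ∩ cyl w).Nonempty := by
  have : w ∈ wordsOfLen (language (sGapShift S)) n := by simpa [gapWords] using hw
  obtain ⟨x, hx, k, hk⟩ := this.1
  refine ⟨shift^[k] x, shift_iterate_mem hx k, ?_⟩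
  intro i hi
  rw [shift_iterate_apply, zero_add]
  exact hk i hi

theorem ofFn_mem_gapWords {S : Set ℕ} (n : ℕ) {x : SeqSpace (Fin 2)} (hx : x ∈ sGapShift S) :
    List.ofFn (fun i : Fin n => x i) ∈ gapWords S n := by
  have : List.ofFn (fun i : Fin n => x i) ∈ wordsOfLen (language (sGapShift S)) n := by
    refine ⟨⟨x, hx, 0, ?_⟩, by simp⟩
    intro i hi
    simp
  simpa [gapWords] using this

theorem mem_cyl_ofFn (n : ℕ) (x : SeqSpace (Fin 2)) :
    x ∈ cyl (List.ofFn (fun i : Fin n => x i)) := by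
  intro i hi
  simp

theorem card_gapWords_le (S : Set ℕ) (n : ℕ) : (gapWords S n).card ≤ 2 ^ n := by
  have : gapWords S n ⊆ (Finset.univ : Finset (Fin n → Fin 2)).image List.ofFn := by
    intro w hw
    have hl := length_of_mem_gapWords hw
    subst hl
    simp only [Finset.mem_image, Finset.mem_univ, true_and]
    exact ⟨fun i => w[i], by simp⟩
  calc _ ≤ _ := Finset.card_le_card this
    _ ≤ (Finset.univ : Finset (Fin n → Fin 2)).card := Finset.card_image_le
    _ = 2 ^ n := by simp

/-- The weight of a word. -/
def wt (S : Set ℕ) (f : SeqSpace (Fin 2) → ℝ) (s : ℝ) (n : ℕ) (w : List (Fin 2)) : ℝ :=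
  sSup (birkhoff (fun x => -(s * (f x + 1))) n '' (sGapShift S ∩ cyl w))

/-- The partition sum. -/
def Zsum (S : Set ℕ) (f : SeqSpace (Fin 2) → ℝ) (s : ℝ) (n : ℕ) : ℝ :=
  ∑ w ∈ gapWords S n, Real.exp (wt S f s n w)

theorem pressure_eq (S : Set ℕ) (f : SeqSpace (Fin 2) → ℝ) (s : ℝ) :
    pressure (sGapShift S) (language (sGapShift S)) (fun x => -(s * (f x + 1))) =
      limsup (fun n : ℕ => Real.log (Zsum S f s n) / n) atTop := by
  unfold pressure Zsum wt gapWords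
  congr 1
  ext n
  rw [finsum_mem_eq_finite_toFinset_sum _ (finite_wordsOfLen S n)]

section
variable {S : Set ℕ} {f : SeqSpace (Fin 2) → ℝ}

theorem le_wt (hfpos : ∀ x ∈ sGapShift S, 0 < f x) {s : ℝ} (hs : 0 ≤ s) {n : ℕ}
    {w : List (Fin 2)} {x : SeqSpace (Fin 2)} (hx : x ∈ sGapShift S) (hxw : x ∈ cyl w) :
    -(s * (birkhoff f n x + n)) ≤ wt S f s n w := by
  apply le_csSup
  · refine ⟨0, ?_⟩
    rintro _ ⟨y, hy, rfl⟩
    rw [birkhoff_pot]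
    have := birkhoff_nonneg hfpos n hy.1
    have : 0 ≤ s * (birkhoff f n y + n) := by positivity
    linarith
  · exact ⟨x, ⟨hx, hxw⟩, birkhoff_pot _ _ _ _⟩

theorem wt_le {s : ℝ} {n : ℕ} {w : List (Fin 2)} (hw : w ∈ gapWords S n) {c : ℝ}
    (h : ∀ x ∈ sGapShift S, x ∈ cyl w → -(s * (birkhoff f n x + n)) ≤ c) :
    wt S f s n w ≤ c := by
  apply csSup_le ((nonempty_of_mem_gapWords hw).image _)
  rintro _ ⟨y, hy, rfl⟩
  rw [birkhoff_pot]
  exact h y hy.1 hy.2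

theorem exists_near_wt {s : ℝ} {n : ℕ} {w : List (Fin 2)} (hw : w ∈ gapWords S n) :
    ∃ x ∈ sGapShift S, x ∈ cyl w ∧ wt S f s n w < -(s * (birkhoff f n x + n)) + 1 := by
  obtain ⟨_, ⟨x, hx, rfl⟩, h⟩ := exists_lt_of_lt_csSup ((nonempty_of_mem_gapWords hw).image
    (birkhoff (fun x => -(s * (f x + 1))) n)) (sub_one_lt (wt S f s n w))
  rw [birkhoff_pot] at h
  exact ⟨x, hx.1, hx.2, by linarith⟩

theorem Zsum_pos (s : ℝ) (n : ℕ) : 0 < Zsum S f s n :=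
  Finset.sum_pos (fun _ _ => Real.exp_pos _) ⟨_, ofFn_mem_gapWords n (zero_mem_sGapShift S)⟩

theorem Zsum_le_two_pow (hfpos : ∀ x ∈ sGapShift S, 0 < f x) {s : ℝ} (hs : 0 ≤ s) (n : ℕ) :
    Zsum S f s n ≤ 2 ^ n := by
  have h1 : Zsum S f s n ≤ ∑ w ∈ gapWords S n, (1 : ℝ) := by
    apply Finset.sum_le_sum
    intro w hw
    rw [Real.exp_le_one_iff]
    apply wt_le hw
    intro x hx _
    have := birkhoff_nonneg hfpos n hx
    have : 0 ≤ s * (birkhoff f n x + n) := by positivity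
    linarith
  refine h1.trans ?_
  rw [Finset.sum_const, nsmul_eq_mul, mul_one]
  exact_mod_cast card_gapWords_le S n

theorem one_le_Zsum_zero (n : ℕ) (hfpos : ∀ x ∈ sGapShift S, 0 < f x) : 1 ≤ Zsum S f 0 n := by
  have hx := zero_mem_sGapShift S
  have h1 := le_wt hfpos le_rfl (n := n) hx (mem_cyl_ofFn n _)
  have h2 : Real.exp (wt S f 0 n _) ≤ Zsum S f 0 n :=
    Finset.single_le_sum (f := fun w => Real.exp (wt S f 0 n w))
      (fun _ _ => (Real.exp_pos _).le) (ofFn_mem_gapWords n hx)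
  refine le_trans ?_ h2
  rw [Real.one_le_exp_iff]
  simpa using h1

theorem Zsum_upper (hfpos : ∀ x ∈ sGapShift S, 0 < f x) {s t : ℝ} (hs : 0 ≤ s) (hst : s ≤ t)
    (n : ℕ) : Zsum S f t n ≤ Real.exp (-((t - s) * n)) * Zsum S f s n := by
  unfold Zsum
  rw [Finset.mul_sum]
  apply Finset.sum_le_sum
  intro w hw
  rw [← Real.exp_add, Real.exp_le_exp]
  apply wt_le hw
  intro x hx hxw
  have h1 := le_wt hfpos hs (n := n) hx hxw
  have h2 := birkhoff_nonneg hfpos n hx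
  nlinarith [mul_nonneg (sub_nonneg.2 hst) h2]

theorem Zsum_lower (hfpos : ∀ x ∈ sGapShift S, 0 < f x) {F : ℝ}
    (hF : ∀ x ∈ sGapShift S, f x ≤ F) {s t : ℝ} (hs : 0 ≤ s) (hst : s ≤ t)
    (n : ℕ) : Zsum S f s n ≤ Real.exp ((t - s) * (F + 1) * n) * Zsum S f t n := by
  unfold Zsum
  rw [Finset.mul_sum]
  apply Finset.sum_le_sum
  intro w hw
  rw [← Real.exp_add, Real.exp_le_exp]
  apply wt_le hw
  intro x hx hxw
  have h1 := le_wt hfpos (hs.trans hst) (n := n) hx hxw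
  have h2 := birkhoff_le hF n hx
  nlinarith [mul_le_mul_of_nonneg_left h2 (sub_nonneg.2 hst)]

/-- The normalised log partition sums. -/
def aSeq (S : Set ℕ) (f : SeqSpace (Fin 2) → ℝ) (s : ℝ) (n : ℕ) : ℝ :=
  Real.log (Zsum S f s n) / n

theorem aSeq_upper (hfpos : ∀ x ∈ sGapShift S, 0 < f x) {s t : ℝ} (hs : 0 ≤ s) (hst : s ≤ t)
    {n : ℕ} (hn : 0 < n) : aSeq S f t n ≤ aSeq S f s n - (t - s) := by
  have h := Real.log_le_log (Zsum_pos t n) (Zsum_upper hfpos hs hst n)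
  rw [Real.log_mul (Real.exp_pos _).ne' (Zsum_pos s n).ne', Real.log_exp] at h
  have hn' : (0 : ℝ) < n := by exact_mod_cast hn
  unfold aSeq
  rw [div_le_iff₀ hn', sub_mul, div_mul_cancel₀ _ hn'.ne']
  linarith

theorem aSeq_lower (hfpos : ∀ x ∈ sGapShift S, 0 < f x) {F : ℝ}
    (hF : ∀ x ∈ sGapShift S, f x ≤ F) {s t : ℝ} (hs : 0 ≤ s) (hst : s ≤ t)
    {n : ℕ} (hn : 0 < n) : aSeq S f s n ≤ aSeq S f t n + (t - s) * (F + 1) := by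
  have h := Real.log_le_log (Zsum_pos s n) (Zsum_lower hfpos hF hs hst n)
  rw [Real.log_mul (Real.exp_pos _).ne' (Zsum_pos t n).ne', Real.log_exp] at h
  have hn' : (0 : ℝ) < n := by exact_mod_cast hn
  unfold aSeq
  rw [div_le_iff₀ hn', add_mul, div_mul_cancel₀ _ hn'.ne']
  linarith

theorem aSeq_zero_nonneg (hfpos : ∀ x ∈ sGapShift S, 0 < f x) (n : ℕ) : 0 ≤ aSeq S f 0 n :=
  div_nonneg (Real.log_nonneg (one_le_Zsum_zero n hfpos)) (Nat.cast_nonneg _)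

theorem aSeq_bddAbove (hfpos : ∀ x ∈ sGapShift S, 0 < f x) {s : ℝ} (hs : 0 ≤ s) :
    IsBoundedUnder (· ≤ ·) atTop (aSeq S f s) := by
  refine isBoundedUnder_of_eventually_le (a := Real.log 2) ?_
  filter_upwards [eventually_gt_atTop 0] with n hn
  have hn' : (0 : ℝ) < n := by exact_mod_cast hn
  have h := Real.log_le_log (Zsum_pos s n) (Zsum_le_two_pow hfpos hs n)
  rw [Real.log_pow] at h
  unfold aSeq
  rw [div_le_iff₀ hn']
  linarith

theorem aSeq_bddBelow (hfpos : ∀ x ∈ sGapShift S, 0 < f x) {F : ℝ}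
    (hF : ∀ x ∈ sGapShift S, f x ≤ F) {s : ℝ} (hs : 0 ≤ s) :
    IsBoundedUnder (· ≥ ·) atTop (aSeq S f s) := by
  refine isBoundedUnder_of_eventually_ge (a := -(s * (F + 1))) ?_
  filter_upwards [eventually_gt_atTop 0] with n hn
  have h := aSeq_lower hfpos hF le_rfl hs hn
  have h0 := aSeq_zero_nonneg hfpos n
  linarith

/-- The pressure function. -/
def pr (S : Set ℕ) (f : SeqSpace (Fin 2) → ℝ) (s : ℝ) : ℝ := limsup (aSeq S f s) atTop

theorem pr_upper (hfpos : ∀ x ∈ sGapShift S, 0 < f x) {F : ℝ}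
    (hF : ∀ x ∈ sGapShift S, f x ≤ F) {s t : ℝ} (hs : 0 ≤ s) (hst : s ≤ t) :
    pr S f t ≤ pr S f s - (t - s) := by
  have h1 : limsup (fun n => aSeq S f t n + (t - s)) atTop = pr S f t + (t - s) :=
    limsup_add_const _ _ _ (aSeq_bddAbove hfpos (hs.trans hst))
      (aSeq_bddBelow hfpos hF (hs.trans hst)).isCoboundedUnder_le
  have h2 : limsup (fun n => aSeq S f t n + (t - s)) atTop ≤ pr S f s := by
    apply limsup_le_limsup
    · filter_upwards [eventually_gt_atTop 0] with n hn
      have := aSeq_upper hfpos hs hst hn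
      linarith
    · apply IsBoundedUnder.isCoboundedUnder_le
      obtain ⟨b, hb⟩ := aSeq_bddBelow hfpos hF (hs.trans hst)
      refine isBoundedUnder_of_eventually_ge (a := b + (t - s)) ?_
      rw [eventually_map] at hb
      filter_upwards [hb] with n hn
      linarith
    · exact aSeq_bddAbove hfpos hs
  linarith

theorem pr_lower (hfpos : ∀ x ∈ sGapShift S, 0 < f x) {F : ℝ}
    (hF : ∀ x ∈ sGapShift S, f x ≤ F) {s t : ℝ} (hs : 0 ≤ s) (hst : s ≤ t) :
    pr S f s ≤ pr S f t + (t - s) * (F + 1) := by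
  rw [pr, pr, ← limsup_add_const _ _ _ (aSeq_bddAbove hfpos (hs.trans hst))
      (aSeq_bddBelow hfpos hF (hs.trans hst)).isCoboundedUnder_le]
  apply limsup_le_limsup
  · filter_upwards [eventually_gt_atTop 0] with n hn
    exact aSeq_lower hfpos hF hs hst hn
  · exact (aSeq_bddBelow hfpos hF hs).isCoboundedUnder_le
  · obtain ⟨b, hb⟩ := aSeq_bddAbove (f := f) hfpos (hs.trans hst)
    refine isBoundedUnder_of_eventually_le (a := b + (t - s) * (F + 1)) ?_
    rw [eventually_map] at hb
    filter_upwards [hb] with n hn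
    linarith

theorem pr_zero_nonneg (hfpos : ∀ x ∈ sGapShift S, 0 < f x) : 0 ≤ pr S f 0 := by
  apply le_limsup_of_frequently_le
  · exact Eventually.frequently (Eventually.of_forall fun n => aSeq_zero_nonneg hfpos n)
  · exact aSeq_bddAbove hfpos le_rfl

theorem pr_strictAnti (hfpos : ∀ x ∈ sGapShift S, 0 < f x) {F : ℝ}
    (hF : ∀ x ∈ sGapShift S, f x ≤ F) {s t : ℝ} (hs : 0 ≤ s) (hst : s < t) :
    pr S f t < pr S f s := by
  have := pr_upper hfpos hF hs hst.le
  linarith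

theorem existsUnique_pr (hfpos : ∀ x ∈ sGapShift S, 0 < f x) {F : ℝ} (hF0 : 0 ≤ F)
    (hF : ∀ x ∈ sGapShift S, f x ≤ F) : ∃! s : ℝ, 0 ≤ s ∧ pr S f s = 0 := by
  have h0 := pr_zero_nonneg (f := f) hfpos
  have hcont : ContinuousOn (pr S f) (Icc 0 (pr S f 0)) := by
    have : LipschitzOnWith (Real.toNNReal (F + 1)) (pr S f) (Icc 0 (pr S f 0)) := by
      apply LipschitzOnWith.of_le_add_mul
      intro x hx y hy
      rw [Real.coe_toNNReal _ (by linarith), Real.dist_eq]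
      rcases le_total x y with hxy | hxy
      · have := pr_lower hfpos hF hx.1 hxy
        rw [abs_of_nonpos (by linarith)]
        linarith
      · have := pr_upper hfpos hF hy.1 hxy
        have : 0 ≤ (F + 1) * |x - y| := by positivity
        linarith
    exact this.continuousOn
  have hivt := intermediate_value_Icc' h0 hcont
  have h1 := pr_upper hfpos hF le_rfl h0
  obtain ⟨s, hs, hs0⟩ := hivt (show (0 : ℝ) ∈ Icc _ _ from ⟨by linarith, h0⟩)
  refine ⟨s, ⟨hs.1, hs0⟩, ?_⟩
  rintro t ⟨ht, ht0⟩
  rcases lt_trichotomy t s with h | h | h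
  · have := pr_strictAnti hfpos hF ht h
    linarith
  · exact h
  · have := pr_strictAnti hfpos hF hs.1 h
    linarith

end

/-! ### The upper bound for the dimension -/

section
variable {S : Set ℕ} {f : SeqSpace (Fin 2) → ℝ}

/-- Points in the cylinder of `w` with a good return at time `n`. -/
def retSet (S : Set ℕ) (f : SeqSpace (Fin 2) → ℝ) (n : ℕ) (w : List (Fin 2)) :
    Set (SeqSpace (Fin 2)) :=
  {x | x ∈ sGapShift S ∧ x ∈ cyl w ∧ dist (shift^[n] x) x ≤ Real.exp (-(birkhoff f n x))}

theorem retSet_lcp {n : ℕ} {w : List (Fin 2)} (hw : w.length = n) {x y : SeqSpace (Fin 2)}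
    (hx : x ∈ retSet S f n w) (hy : y ∈ retSet S f n w) (hxy : x ≠ y) :
    (n : ℝ) + birkhoff f n x ≤ lcp x y ∨ (n : ℝ) + birkhoff f n y ≤ lcp x y := by
  by_contra hcon
  push Not at hcon
  obtain ⟨h1, h2⟩ := hcon
  have hne := lcp_mem hxy
  have hn : n ≤ lcp x y := by
    by_contra hlt
    push Not at hlt
    have ha := hx.2.1 (lcp x y) (by omega)
    have hb := hy.2.1 (lcp x y) (by omega)
    rw [zero_add] at ha hb
    exact hne (ha.trans hb.symm)
  obtain ⟨q, hq⟩ := Nat.exists_eq_add_of_le hn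
  have hqr : (lcp x y : ℝ) = n + q := by rw [hq]; push_cast; ring
  have ex := agree_of_dist_le hx.2.2 (i := q) (by linarith)
  have ey := agree_of_dist_le hy.2.2 (i := q) (by linarith)
  rw [shift_iterate_apply, ← hq] at ex ey
  rcases Nat.eq_zero_or_pos n with h0 | h0
  · subst h0
    simp [birkhoff] at h1
    have : (0 : ℝ) ≤ lcp x y := Nat.cast_nonneg _
    linarith
  · have : x q = y q := eq_of_lt_lcp (by omega)
    exact hne (by rw [ex, ey, this])

theorem retSet_dist (hfpos : ∀ x ∈ sGapShift S, 0 < f x) {t : ℝ} (ht : 0 < t) {n : ℕ}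
    {w : List (Fin 2)} (hw : w.length = n) {x y : SeqSpace (Fin 2)}
    (hx : x ∈ retSet S f n w) (hy : y ∈ retSet S f n w) :
    dist x y ≤ Real.exp (wt S f t n w / t) := by
  by_cases hxy : x = y
  · rw [hxy, dist_self]; exact (Real.exp_pos _).le
  rw [dist_eq_exp hxy, Real.exp_le_exp, le_div_iff₀ ht]
  rcases retSet_lcp hw hx hy hxy with h | h
  · have := le_wt hfpos ht.le (n := n) hx.1 hx.2.1
    nlinarith
  · have := le_wt hfpos ht.le (n := n) hy.1 hy.2.1
    nlinarith

theorem retSet_dist' (hfpos : ∀ x ∈ sGapShift S, 0 < f x) {n : ℕ}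
    {w : List (Fin 2)} (hw : w.length = n) {x y : SeqSpace (Fin 2)}
    (hx : x ∈ retSet S f n w) (hy : y ∈ retSet S f n w) :
    dist x y ≤ Real.exp (-(n : ℝ)) := by
  by_cases hxy : x = y
  · rw [hxy, dist_self]; exact (Real.exp_pos _).le
  rw [dist_eq_exp hxy, Real.exp_le_exp]
  rcases retSet_lcp hw hx hy hxy with h | h
  · linarith [birkhoff_nonneg hfpos n hx.1]
  · linarith [birkhoff_nonneg hfpos n hy.1]

open scoped Classical in
/-- The cover at stage `k`. -/
def coverSet (S : Set ℕ) (f : SeqSpace (Fin 2) → ℝ) (n₀ k : ℕ)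
    (i : (n : ℕ) × {w // w ∈ gapWords S n}) : Set (SeqSpace (Fin 2)) :=
  if n₀ ≤ i.1 ∧ k ≤ i.1 then retSet S f i.1 i.2.1 else ∅

theorem ediam_le_ofReal {E : Set (SeqSpace (Fin 2))} {c : ℝ}
    (h : ∀ x ∈ E, ∀ y ∈ E, dist x y ≤ c) : Metric.ediam E ≤ ENNReal.ofReal c := by
  apply Metric.ediam_le
  intro x hx y hy
  rw [edist_dist]
  exact ENNReal.ofReal_le_ofReal (h x hx y hy)

theorem dimH_le_of_pr_neg (hfpos : ∀ x ∈ sGapShift S, 0 < f x) {t : ℝ} (ht : 0 < t)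
    (hpr : pr S f t < 0) : dimH (recSetF (sGapShift S) f) ≤ ENNReal.ofReal t := by
  borelize (SeqSpace (Fin 2))
  obtain ⟨δ, hδ, hδ'⟩ : ∃ δ : ℝ, 0 < δ ∧ pr S f t < -δ := ⟨-(pr S f t) / 2, by linarith, by linarith⟩
  have hev := eventually_lt_of_limsup_lt hδ' (aSeq_bddAbove hfpos ht.le)
  obtain ⟨n₀, hn₀⟩ := eventually_atTop.mp (hev.and (eventually_gt_atTop 0))
  have hZ : ∀ n ≥ n₀, Zsum S f t n ≤ Real.exp (-δ * n) := by
    intro n hn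
    obtain ⟨h1, h2⟩ := hn₀ n hn
    have hn' : (0 : ℝ) < n := by exact_mod_cast h2
    unfold aSeq at h1
    rw [div_lt_iff₀ hn', Real.log_lt_iff_lt_exp (Zsum_pos t n)] at h1
    exact h1.le
  have hsum : Summable (fun n : ℕ => Real.exp (-δ * n)) := by
    have := Real.summable_exp_nat_mul_iff.mpr (show -δ < 0 by linarith)
    simpa [mul_comm] using this
  have key : μH[t] (recSetF (sGapShift S) f) ≤ ∑' n : ℕ, ENNReal.ofReal (Real.exp (-δ * n)) := by
    refine (Measure.hausdorffMeasure_le_liminf_tsum (l := atTop) t _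
      (fun k : ℕ => ENNReal.ofReal (Real.exp (-(k : ℝ)))) ?_ (coverSet S f n₀) ?_ ?_).trans ?_
    · rw [← ENNReal.ofReal_zero]
      exact ENNReal.tendsto_ofReal
        (Real.tendsto_exp_neg_atTop_nhds_zero.comp tendsto_natCast_atTop_atTop)
    · refine Eventually.of_forall fun k => ?_
      rintro ⟨n, w, hw⟩
      apply ediam_le_ofReal
      intro x hx y hy
      unfold coverSet at hx hy
      split_ifs at hx hy with hcond
      · refine (retSet_dist' hfpos (length_of_mem_gapWords hw) hx hy).trans ?_
        rw [Real.exp_le_exp]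
        have : (k : ℝ) ≤ n := by exact_mod_cast hcond.2
        linarith
      · exact absurd hx (notMem_empty _)
    · refine Eventually.of_forall fun k => ?_
      rintro x ⟨hx, hfr⟩
      obtain ⟨n, hn, hd⟩ := (frequently_atTop.mp hfr) (max n₀ k)
      rw [mem_iUnion]
      refine ⟨⟨n, _, ofFn_mem_gapWords n hx⟩, ?_⟩
      unfold coverSet
      rw [if_pos ⟨(le_max_left _ _).trans hn, (le_max_right _ _).trans hn⟩]
      exact ⟨hx, mem_cyl_ofFn n x, hd⟩
    · refine (liminf_le_of_frequently_le' (Eventually.frequently (Eventually.of_forall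
        fun k => ?_)))
      rw [ENNReal.tsum_sigma']
      refine ENNReal.tsum_le_tsum fun n => ?_
      by_cases hn : n₀ ≤ n
      · calc ∑' w : {w // w ∈ gapWords S n}, Metric.ediam (coverSet S f n₀ k ⟨n, w⟩) ^ t
            ≤ ∑' w : {w // w ∈ gapWords S n}, ENNReal.ofReal (Real.exp (wt S f t n w)) := by
              refine ENNReal.tsum_le_tsum fun w => ?_
              have : Metric.ediam (coverSet S f n₀ k ⟨n, w⟩) ≤
                  ENNReal.ofReal (Real.exp (wt S f t n w / t)) := by
                apply ediam_le_ofReal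
                intro x hx y hy
                unfold coverSet at hx hy
                split_ifs at hx hy with hcond
                · exact retSet_dist hfpos ht (length_of_mem_gapWords w.2) hx hy
                · exact absurd hx (notMem_empty _)
              refine (ENNReal.rpow_le_rpow this ht.le).trans ?_
              rw [ENNReal.ofReal_rpow_of_pos (Real.exp_pos _), ← Real.exp_mul,
                div_mul_cancel₀ _ ht.ne']
          _ = ENNReal.ofReal (Zsum S f t n) := by
              rw [tsum_fintype, Zsum, ENNReal.ofReal_sum_of_nonneg
                (fun _ _ => (Real.exp_pos _).le)]
              exact Finset.sum_coe_sort (gapWords S n)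
                (fun w => ENNReal.ofReal (Real.exp (wt S f t n w)))
          _ ≤ _ := ENNReal.ofReal_le_ofReal (hZ n hn)
      · have : ∀ w, Metric.ediam (coverSet S f n₀ k ⟨n, w⟩) ^ t = 0 := by
          intro w
          unfold coverSet
          rw [if_neg (fun h => hn h.1)]
          simp [ht]
        simp [this]
  have hne : μH[((Real.toNNReal t : ℝ≥0) : ℝ)] (recSetF (sGapShift S) f) ≠ ∞ := by
    rw [Real.coe_toNNReal _ ht.le]
    exact ne_top_of_le_ne_top hsum.tsum_ofReal_ne_top key
  exact dimH_le_of_hausdorffMeasure_ne_top hne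

end

/-! ### Extracting a large family of freely concatenable blocks -/

section
variable {S : Set ℕ} {f : SeqSpace (Fin 2) → ℝ}

theorem birkhoff_distortion (hfpos : ∀ x ∈ sGapShift S, 0 < f x) {F : ℝ} (hF0 : 0 ≤ F)
    (hF : ∀ x ∈ sGapShift S, f x ≤ F) {ε : ℝ} (hε : 0 ≤ ε) {m : ℕ}
    (hm : ∀ x ∈ sGapShift S, ∀ y ∈ sGapShift S, (∀ i < m, x i = y i) → f x ≤ f y + ε)
    {ℓ : ℕ} {z y : SeqSpace (Fin 2)} (hz : z ∈ sGapShift S) (hy : y ∈ sGapShift S)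
    (hzy : ∀ i < ℓ, z i = y i) :
    birkhoff f ℓ z ≤ birkhoff f ℓ y + (ℓ * ε + m * F) := by
  have h1 : birkhoff f ℓ z ≤
      ∑ i ∈ Finset.range ℓ, (f (shift^[i] y) + ε + if ℓ < i + m then F else 0) := by
    apply Finset.sum_le_sum
    intro i hi
    rw [Finset.mem_range] at hi
    split_ifs with h
    · have := hF _ (shift_iterate_mem hz i)
      have := hfpos _ (shift_iterate_mem hy i)
      linarith
    · have := hm _ (shift_iterate_mem hz i) _ (shift_iterate_mem hy i) (fun j hj => by
        rw [shift_iterate_apply, shift_iterate_apply]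
        exact hzy _ (by omega))
      linarith
  have h2 : ∑ i ∈ Finset.range ℓ, (if ℓ < i + m then F else 0) ≤ m * F := by
    rw [← Finset.sum_filter, Finset.sum_const, nsmul_eq_mul]
    have hsub : (Finset.range ℓ).filter (fun i => ℓ < i + m) ⊆ Finset.Ico (ℓ - m) ℓ := by
      intro i hi
      rw [Finset.mem_filter, Finset.mem_range] at hi
      rw [Finset.mem_Ico]
      omega
    have hc := Finset.card_le_card hsub
    rw [Nat.card_Ico] at hc
    have hc' : ((Finset.range ℓ).filter (fun i => ℓ < i + m)).card ≤ m := by omega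
    have : (((Finset.range ℓ).filter (fun i => ℓ < i + m)).card : ℝ) ≤ m := by exact_mod_cast hc'
    exact mul_le_mul_of_nonneg_right this hF0
  rw [Finset.sum_add_distrib, Finset.sum_add_distrib, Finset.sum_const, Finset.card_range,
    nsmul_eq_mul] at h1
  have h3 : birkhoff f ℓ y = ∑ i ∈ Finset.range ℓ, f (shift^[i] y) := rfl
  linarith

/-- A family of `M` distinct blocks of length `ℓ`, freely concatenable in the gap shift, with
Birkhoff sums at most `k`. -/
def IsBlockFamily (S : Set ℕ) (f : SeqSpace (Fin 2) → ℝ) (ℓ k M : ℕ)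
    (V : Fin M → ℕ → Fin 2) : Prop :=
  (∀ u u', u ≠ u' → ∃ i < ℓ, V u i ≠ V u' i) ∧
  (∀ u, ∃ x ∈ sGapShift S, x 0 = 1 ∧ x ℓ = 1 ∧ ∀ i < ℓ, V u i = x (i + 1)) ∧
  (∀ u, ∀ z ∈ sGapShift S, (∀ i < ℓ, z i = V u i) → birkhoff f ℓ z ≤ k)

theorem list_eq_of_cyl {w w' : List (Fin 2)} {n : ℕ} (hw : w.length = n) (hw' : w'.length = n)
    {x x' : SeqSpace (Fin 2)} (hx : x ∈ cyl w) (hx' : x' ∈ cyl w')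
    (h : ∀ i < n, x i = x' i) : w = w' := by
  apply List.ext_getElem (by omega)
  intro i h1 h2
  have e1 := hx i h1
  have e2 := hx' i h2
  rw [zero_add] at e1 e2
  rw [← e1, ← e2]
  exact h i (by omega)

theorem fin2_eq_zero {a : Fin 2} (h : a ≠ 1) : a = 0 := by omega

open scoped Classical in
theorem blocks_of_big (hfpos : ∀ x ∈ sGapShift S, 0 < f x) {F : ℝ} (hF0 : 0 ≤ F)
    (hF : ∀ x ∈ sGapShift S, f x ≤ F) {ε : ℝ} (hε : 0 ≤ ε) {m : ℕ}
    (hm : ∀ x ∈ sGapShift S, ∀ y ∈ sGapShift S, (∀ i < m, x i = y i) → f x ≤ f y + ε)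
    {t : ℝ} (ht : 0 < t) {N : ℕ} (hN : 0 < N)
    (hZ : 1 + (N : ℝ) * (N * ((⌈(N : ℝ) * (F + ε) + m * F⌉₊ + 1 : ℕ) : ℝ)) *
      Real.exp (1 + t + t * (N * ε + m * F)) < Zsum S f t N) :
    ∃ ℓ k M : ℕ, 0 < ℓ ∧ 2 ≤ M ∧ Real.exp (t * (ℓ + k)) ≤ M ∧
      ∃ V : Fin M → ℕ → Fin 2, IsBlockFamily S f ℓ k M V := by
  set D : ℝ := N * ε + m * F with hD
  have hD0 : 0 ≤ D := by positivity
  set K : ℕ := ⌈(N : ℝ) * (F + ε) + m * F⌉₊ + 1 with hK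
  have hch : ∀ w : List (Fin 2), ∃ x : SeqSpace (Fin 2), w ∈ gapWords S N →
      x ∈ sGapShift S ∧ x ∈ cyl w ∧ wt S f t N w < -(t * (birkhoff f N x + N)) + 1 := by
    intro w
    by_cases hw : w ∈ gapWords S N
    · obtain ⟨x, h1, h2, h3⟩ := exists_near_wt (f := f) (s := t) hw
      exact ⟨x, fun _ => ⟨h1, h2, h3⟩⟩
    · exact ⟨fun _ => 0, fun h => absurd h hw⟩
  choose x hx using hch
  let kk : List (Fin 2) → ℕ := fun w => ⌈birkhoff f N (x w) + D⌉₊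
  let A : List (Fin 2) → ℕ := fun w => sInf {i | x w i = 1}
  let B : List (Fin 2) → ℕ := fun w => Nat.findGreatest (fun i => x w i = 1) (N - 1)
  let cls : List (Fin 2) → ℕ × ℕ × ℕ := fun w => (A w, B w, kk w)
  let W1 := (gapWords S N).filter (fun w => ∃ i < N, x w i = 1)
  have hA1 : ∀ w ∈ W1, x w (A w) = 1 := by
    intro w hw
    obtain ⟨i, _, hi⟩ := (Finset.mem_filter.mp hw).2
    exact Nat.sInf_mem (s := {i | x w i = 1}) ⟨i, hi⟩
  have hA2 : ∀ w, ∀ j < A w, x w j = 0 := by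
    intro w j hj
    apply fin2_eq_zero
    intro h
    have : A w ≤ j := Nat.sInf_le h
    omega
  have hB1 : ∀ w ∈ W1, x w (B w) = 1 := by
    intro w hw
    obtain ⟨i, hi, h1⟩ := (Finset.mem_filter.mp hw).2
    exact Nat.findGreatest_spec (P := fun i => x w i = 1) (m := i) (by omega) h1
  have hBN : ∀ w, B w < N := by
    intro w
    have : B w ≤ N - 1 := Nat.findGreatest_le _
    omega
  have hB2 : ∀ w, ∀ j, B w < j → j < N → x w j = 0 := by
    intro w j hj hjN
    apply fin2_eq_zero
    exact Nat.findGreatest_is_greatest (P := fun i => x w i = 1) hj (by omega)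
  have hAB : ∀ w ∈ W1, A w ≤ B w := fun w hw => Nat.sInf_le (hB1 w hw)
  have hsplit : Zsum S f t N = ∑ w ∈ W1, Real.exp (wt S f t N w) +
      ∑ w ∈ (gapWords S N).filter (fun w => ¬ ∃ i < N, x w i = 1), Real.exp (wt S f t N w) :=
    (Finset.sum_filter_add_sum_filter_not _ _ _).symm
  have hzero : ∑ w ∈ (gapWords S N).filter (fun w => ¬ ∃ i < N, x w i = 1),
      Real.exp (wt S f t N w) ≤ 1 := by
    have hcard : ((gapWords S N).filter (fun w => ¬ ∃ i < N, x w i = 1)).card ≤ 1 := by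
      rw [Finset.card_le_one]
      intro w hw w' hw'
      rw [Finset.mem_filter] at hw hw'
      apply list_eq_of_cyl (length_of_mem_gapWords hw.1) (length_of_mem_gapWords hw'.1)
        (hx w hw.1).2.1 (hx w' hw'.1).2.1
      intro i hi
      rw [fin2_eq_zero (fun h => hw.2 ⟨i, hi, h⟩), fin2_eq_zero (fun h => hw'.2 ⟨i, hi, h⟩)]
    have h1 : ∀ w ∈ (gapWords S N).filter (fun w => ¬ ∃ i < N, x w i = 1),
        Real.exp (wt S f t N w) ≤ 1 := by
      intro w hw
      rw [Real.exp_le_one_iff]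
      apply wt_le (Finset.mem_filter.mp hw).1
      intro y hy _
      have := birkhoff_nonneg hfpos N hy
      have : 0 ≤ t * (birkhoff f N y + N) := by positivity
      linarith
    have h2 := Finset.sum_le_card_nsmul _ _ _ h1
    rw [nsmul_eq_mul, mul_one] at h2
    have : ((((gapWords S N).filter (fun w => ¬ ∃ i < N, x w i = 1)).card : ℕ) : ℝ) ≤ 1 := by
      exact_mod_cast hcard
    linarith
  have hmaps : ∀ w ∈ W1, cls w ∈ Finset.range N ×ˢ (Finset.range N ×ˢ Finset.range K) := by
    intro w hw
    have hw' := (Finset.mem_filter.mp hw).1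
    simp only [Finset.mem_product, Finset.mem_range, cls]
    refine ⟨lt_of_le_of_lt (hAB w hw) (hBN w), hBN w, ?_⟩
    rw [hK, Nat.lt_add_one_iff]
    apply Nat.ceil_mono
    have := birkhoff_le hF N (hx w hw').1
    rw [hD]
    linarith
  have hex : ∃ p : ℕ × ℕ × ℕ, Real.exp (t * (N + p.2.2)) ≤
      ((W1.filter (fun w => cls w = p)).card : ℝ) := by
    by_contra hcon
    push Not at hcon
    have h1 : ∑ w ∈ W1, Real.exp (wt S f t N w) ≤
        ∑ p ∈ Finset.range N ×ˢ (Finset.range N ×ˢ Finset.range K), Real.exp (1 + t + t * D) := by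
      rw [← Finset.sum_fiberwise_of_maps_to hmaps]
      apply Finset.sum_le_sum
      intro p _
      have h2 : ∀ w ∈ W1.filter (fun w => cls w = p), Real.exp (wt S f t N w) ≤
          Real.exp (1 + t + t * D) * Real.exp (-(t * (N + p.2.2))) := by
        intro w hw
        obtain ⟨hw1, hw2⟩ := Finset.mem_filter.mp hw
        have hw' := (Finset.mem_filter.mp hw1).1
        rw [← Real.exp_add, Real.exp_le_exp]
        have h3 := (hx w hw').2.2
        have h4 : (p.2.2 : ℝ) < birkhoff f N (x w) + D + 1 := by
          rw [← hw2]
          exact Nat.ceil_lt_add_one (add_nonneg (birkhoff_nonneg hfpos N (hx w hw').1) hD0)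
        nlinarith [mul_lt_mul_of_pos_left h4 ht]
      have h3 := Finset.sum_le_card_nsmul _ _ _ h2
      rw [nsmul_eq_mul] at h3
      refine h3.trans ?_
      have h4 := (hcon p).le
      calc _ ≤ Real.exp (t * (N + p.2.2)) *
            (Real.exp (1 + t + t * D) * Real.exp (-(t * (N + p.2.2)))) :=
            mul_le_mul_of_nonneg_right h4 (by positivity)
        _ = Real.exp (1 + t + t * D) := by
            rw [← Real.exp_add, ← Real.exp_add]
            congr 1
            ring
    rw [Finset.sum_const, nsmul_eq_mul, Finset.card_product, Finset.card_product,
      Finset.card_range, Finset.card_range] at h1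
    push_cast at h1 hZ
    linarith
  obtain ⟨⟨a, b, k⟩, hp⟩ := hex
  simp only at hp
  set C := W1.filter (fun w => cls w = (a, b, k)) with hC
  have hCw : ∀ w ∈ C, w ∈ gapWords S N ∧ w ∈ W1 ∧ A w = a ∧ B w = b ∧ kk w = k := by
    intro w hw
    obtain ⟨h1, h2⟩ := Finset.mem_filter.mp hw
    simp only [cls, Prod.mk.injEq] at h2
    exact ⟨(Finset.mem_filter.mp h1).1, h1, h2⟩
  have hM1 : (1 : ℝ) < C.card := by
    refine lt_of_lt_of_le ?_ hp
    rw [Real.one_lt_exp_iff]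
    have : (0 : ℝ) < N := by exact_mod_cast hN
    positivity
  have hM : 2 ≤ C.card := by exact_mod_cast hM1
  let e : Fin C.card ≃ C := C.equivFin.symm
  have hinj : ∀ u u', u ≠ u' → ∃ i < b - a,
      x (e u).1 (a + 1 + i) ≠ x (e u').1 (a + 1 + i) := by
    intro u u' huu
    by_contra hcon
    push Not at hcon
    apply huu
    apply e.injective
    apply Subtype.ext
    obtain ⟨g1, g2, g3, g4, _⟩ := hCw _ (e u).2
    obtain ⟨g1', g2', g3', g4', _⟩ := hCw _ (e u').2
    apply list_eq_of_cyl (length_of_mem_gapWords g1) (length_of_mem_gapWords g1')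
      (hx _ g1).2.1 (hx _ g1').2.1
    intro i hi
    rcases lt_trichotomy i a with h | h | h
    · rw [hA2 _ i (by omega), hA2 _ i (by omega)]
    · have q1 := hA1 _ g2
      have q2 := hA1 _ g2'
      rw [g3, ← h] at q1
      rw [g3', ← h] at q2
      rw [q1, q2]
    · by_cases hib : i ≤ b
      · have := hcon (i - a - 1) (by omega)
        rwa [show a + 1 + (i - a - 1) = i by omega] at this
      · rw [hB2 _ i (by omega) hi, hB2 _ i (by omega) hi]
  have hab : a < b := by
    obtain ⟨i, hi, _⟩ := hinj ⟨0, by omega⟩ ⟨1, by omega⟩ (by simp)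
    omega
  have hbN : b < N := by
    obtain ⟨_, _, _, g4, _⟩ := hCw _ (e ⟨0, by omega⟩).2
    rw [← g4]
    exact hBN _
  refine ⟨b - a, k, C.card, by omega, hM, ?_, fun u i => x (e u).1 (a + 1 + i), hinj, ?_, ?_⟩
  · refine le_trans ?_ hp
    rw [Real.exp_le_exp]
    have : ((b - a : ℕ) : ℝ) ≤ N := by exact_mod_cast (by omega : b - a ≤ N)
    exact mul_le_mul_of_nonneg_left (by linarith) ht.le
  · intro u
    obtain ⟨g1, g2, g3, g4, _⟩ := hCw _ (e u).2
    refine ⟨shift^[a] (x (e u).1), shift_iterate_mem (hx _ g1).1 a, ?_, ?_, ?_⟩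
    · rw [shift_iterate_apply, add_zero, ← g3]
      exact hA1 _ g2
    · rw [shift_iterate_apply, show a + (b - a) = b by omega, ← g4]
      exact hB1 _ g2
    · intro i _
      rw [shift_iterate_apply, show a + (i + 1) = a + 1 + i by omega]
  · intro u z hz hzV
    obtain ⟨g1, g2, g3, g4, g5⟩ := hCw _ (e u).2
    have hy := (hx _ g1).1
    have h1 := birkhoff_distortion hfpos hF0 hF hε hm hz (shift_iterate_mem hy (a + 1))
      (ℓ := b - a) (fun i hi => by rw [shift_iterate_apply]; exact hzV i hi)
    have h2 : birkhoff f N (x (e u).1) = birkhoff f (a + 1) (x (e u).1) +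
        (birkhoff f (b - a) (shift^[a + 1] (x (e u).1)) +
          birkhoff f (N - b - 1) (shift^[b - a] (shift^[a + 1] (x (e u).1)))) := by
      rw [← birkhoff_add, ← birkhoff_add]
      congr 1
      omega
    have h3 := birkhoff_nonneg hfpos (a + 1) hy
    have h4 := birkhoff_nonneg hfpos (N - b - 1)
      (shift_iterate_mem (shift_iterate_mem hy (a + 1)) (b - a))
    have h5 : birkhoff f N (x (e u).1) + D ≤ k := by
      rw [← g5]
      exact Nat.le_ceil _
    have h6 : ((b - a : ℕ) : ℝ) * ε ≤ N * ε := by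
      apply mul_le_mul_of_nonneg_right _ hε
      exact_mod_cast (by omega : b - a ≤ N)
    linarith

theorem exists_blocks (hfc : ContinuousOn f (sGapShift S))
    (hfpos : ∀ x ∈ sGapShift S, 0 < f x) {t : ℝ} (ht : 0 < t) (hpr : 0 < pr S f t) :
    ∃ ℓ k M : ℕ, 0 < ℓ ∧ 2 ≤ M ∧ Real.exp (t * (ℓ + k)) ≤ M ∧
      ∃ V : Fin M → ℕ → Fin 2, IsBlockFamily S f ℓ k M V := by
  obtain ⟨F, hF0, hF⟩ := exists_bound hfc
  obtain ⟨δ, hδ, hδ'⟩ : ∃ δ : ℝ, 0 < δ ∧ δ < pr S f t := ⟨pr S f t / 2, by linarith, by linarith⟩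
  obtain ⟨ε, hε, hε'⟩ : ∃ ε : ℝ, 0 < ε ∧ t * ε = δ / 2 := ⟨δ / 2 / t, by positivity, by field_simp⟩
  obtain ⟨m, hm⟩ := exists_window hfc hε
  have hfr := frequently_lt_of_lt_limsup (aSeq_bddBelow hfpos hF ht.le).isCoboundedUnder_le hδ'
  set c : ℝ := F + ε + m * F + 2 with hc
  set E : ℝ := Real.exp (1 + t + t * (m * F)) with hE
  have hc0 : 0 < c := by positivity
  have hE0 : 0 < E := Real.exp_pos _
  have hlim : ∀ᶠ N : ℕ in atTop, (N : ℝ) ^ 3 * (c * E + 1) < Real.exp (δ / 2 * N) := by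
    have h1 := (isLittleO_pow_exp_pos_mul_atTop 3 (show 0 < δ / 2 by positivity)).comp_tendsto
      (tendsto_natCast_atTop_atTop (R := ℝ))
    have h2 := h1.def (c := (c * E + 2)⁻¹) (by positivity)
    filter_upwards [h2, eventually_gt_atTop 0] with N hN hN0
    simp only [Function.comp, Real.norm_eq_abs, Real.abs_exp] at hN
    have hN' : (0 : ℝ) < (N : ℝ) ^ 3 := by positivity
    rw [abs_of_pos hN', ← div_eq_inv_mul, le_div_iff₀ (by positivity)] at hN
    nlinarith
  obtain ⟨N, hN1, hN2, hN0⟩ := (hfr.and_eventually (hlim.and (eventually_gt_atTop 0))).exists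
  apply blocks_of_big hfpos hF0 hF hε.le hm ht hN0
  have hN0' : (1 : ℝ) ≤ N := by exact_mod_cast hN0
  have hZ : Real.exp (δ * N) < Zsum S f t N := by
    unfold aSeq at hN1
    rw [lt_div_iff₀ (by linarith), Real.lt_log_iff_exp_lt (Zsum_pos t N)] at hN1
    exact hN1
  refine lt_of_le_of_lt ?_ hZ
  have hK : ((⌈(N : ℝ) * (F + ε) + m * F⌉₊ + 1 : ℕ) : ℝ) ≤ N * c := by
    push_cast
    have h1 := Nat.ceil_lt_add_one (show 0 ≤ (N : ℝ) * (F + ε) + m * F by positivity)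
    have h2 : (m * F : ℝ) ≤ N * (m * F) := le_mul_of_one_le_left (by positivity) hN0'
    rw [hc]
    nlinarith
  have hexp : Real.exp (1 + t + t * (N * ε + m * F)) = E * Real.exp (δ / 2 * N) := by
    rw [hE, ← Real.exp_add]
    congr 1
    rw [← hε']
    ring
  rw [hexp]
  set X := Real.exp (δ / 2 * N) with hX
  have hX1 : 1 ≤ X := by rw [hX, Real.one_le_exp_iff]; positivity
  have hXX : Real.exp (δ * N) = X * X := by
    rw [hX, ← Real.exp_add]
    congr 1
    ring
  rw [hXX]
  have hN3 : (1 : ℝ) ≤ (N : ℝ) ^ 3 := one_le_pow₀ hN0'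
  calc _ ≤ (N : ℝ) ^ 3 * X + (N : ℝ) * (N * (N * c)) * (E * X) := by
        gcongr
        nlinarith
    _ = ((N : ℝ) ^ 3 * (c * E + 1)) * X := by ring
    _ ≤ X * X := by gcongr

end

/-! ### Sequences with prescribed recurrence -/

/-- The largest power of `A` below `j`. -/
def base (A j : ℕ) : ℕ := A ^ Nat.log A j

/-- The number of blocks to be copied at time `p`. -/
def copyLen (k ℓ p : ℕ) : ℕ := p * k / ℓ + 1

/-- Block position `j` is a copied one. -/
def IsCopy (A k ℓ j : ℕ) : Prop :=
  0 < j ∧ 0 < base A j ∧ j < base A j + copyLen k ℓ (base A j)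

open scoped Classical in
/-- The number of free block positions below `n`. -/
def cnt (A k ℓ : ℕ) : ℕ → ℕ
  | 0 => 0
  | n + 1 => cnt A k ℓ n + if IsCopy A k ℓ n then 0 else 1

open scoped Classical in
/-- The sequence of blocks built from the free digits `ω`. -/
def yseq {M : ℕ} (A k ℓ : ℕ) (ω : ℕ → Fin M) (j : ℕ) : Fin M :=
  if h : IsCopy A k ℓ j then yseq A k ℓ ω (j - base A j) else ω (cnt A k ℓ j)
termination_by j
decreasing_by
  have h1 := h.1
  have h2 := h.2.1
  omega

theorem cnt_succ_of_copy {A k ℓ n : ℕ} (h : IsCopy A k ℓ n) :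
    cnt A k ℓ (n + 1) = cnt A k ℓ n := by
  rw [cnt, if_pos h, add_zero]

theorem cnt_succ_of_not_copy {A k ℓ n : ℕ} (h : ¬ IsCopy A k ℓ n) :
    cnt A k ℓ (n + 1) = cnt A k ℓ n + 1 := by
  rw [cnt, if_neg h]

theorem yseq_of_copy {M A k ℓ j : ℕ} {ω : ℕ → Fin M} (h : IsCopy A k ℓ j) :
    yseq A k ℓ ω j = yseq A k ℓ ω (j - base A j) := by
  rw [yseq, dif_pos h]

theorem yseq_of_not_copy {M A k ℓ j : ℕ} {ω : ℕ → Fin M} (h : ¬ IsCopy A k ℓ j) :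
    yseq A k ℓ ω j = ω (cnt A k ℓ j) := by
  rw [yseq, dif_neg h]

theorem digits_eq_of_yseq_eq {M A k ℓ : ℕ} {ω ω' : ℕ → Fin M} {n : ℕ}
    (h : ∀ j < n, yseq A k ℓ ω j = yseq A k ℓ ω' j) : ∀ i < cnt A k ℓ n, ω i = ω' i := by
  induction n with
  | zero => intro i hi; simp [cnt] at hi
  | succ n ih =>
    intro i hi
    have ih' := ih (fun j hj => h j (by omega))
    by_cases hc : IsCopy A k ℓ n
    · rw [cnt_succ_of_copy hc] at hi
      exact ih' i hi
    · rw [cnt_succ_of_not_copy hc] at hi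
      rcases Nat.lt_succ_iff_lt_or_eq.mp hi with h1 | h1
      · exact ih' i h1
      · have := h n (by omega)
        rw [yseq_of_not_copy hc, yseq_of_not_copy hc] at this
        rw [h1, this]

theorem copyLen_le {k ℓ p : ℕ} : copyLen k ℓ p ≤ p * k + 1 := by
  unfold copyLen
  have := Nat.div_le_self (p * k) ℓ
  omega

theorem yseq_copy {M A k ℓ : ℕ} (hA : k + 2 ≤ A) (ω : ℕ → Fin M) (i u : ℕ)
    (hu : u < copyLen k ℓ (A ^ i)) :
    yseq A k ℓ ω (A ^ i + u) = yseq A k ℓ ω u := by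
  have hp : 0 < A ^ i := Nat.pow_pos (by omega)
  have hb : base A (A ^ i + u) = A ^ i := by
    unfold base
    congr 1
    apply Nat.log_eq_of_pow_le_of_lt_pow (by omega)
    have := copyLen_le (k := k) (ℓ := ℓ) (p := A ^ i)
    rw [pow_succ]
    nlinarith
  have hc : IsCopy A k ℓ (A ^ i + u) := by
    refine ⟨by omega, by omega, ?_⟩
    rw [hb]
    omega
  rw [yseq_of_copy hc, hb]
  congr 1
  omega

theorem cnt_claim {A k ℓ : ℕ} (hA : 2 ≤ A) {κ η : ℝ} (hκ : 0 ≤ κ)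
    (hκ' : κ = (k : ℝ) / ℓ) (hη : η = (κ + 2) / ((A : ℝ) - 1)) (j : ℕ) (hj : 1 ≤ j) :
    (j : ℝ) - cnt A k ℓ j ≤ η * base A j + (j - base A j) ∧
    (j : ℝ) - cnt A k ℓ j ≤ η * base A j + κ * base A j + 1 := by
  have hA' : (2 : ℝ) ≤ A := by exact_mod_cast hA
  have hη0 : 0 ≤ η := by rw [hη]; exact div_nonneg (by linarith) (by linarith)
  induction j, hj using Nat.le_induction with
  | base =>
    have h1 : cnt A k ℓ 1 = 1 := by
      rw [cnt_succ_of_not_copy (fun h => absurd h.1 (by omega))]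
      rfl
    have h2 : base A 1 = 1 := by simp [base]
    rw [h1, h2]
    constructor <;> push_cast <;> linarith
  | succ j hj ih =>
    obtain ⟨ih1, ih2⟩ := ih
    have hp1 : 1 ≤ base A j := Nat.pow_pos (by omega)
    have hp1' : (1 : ℝ) ≤ base A j := by exact_mod_cast hp1
    have hle : base A j ≤ j := Nat.pow_log_le_self A (by omega)
    have hlt : j < A * base A j := by
      have := Nat.lt_pow_succ_log_self (b := A) (by omega) j
      rwa [pow_succ, mul_comm] at this
    rcases Nat.lt_or_ge (j + 1) (A * base A j) with hcase | hcase
    · have hb : base A (j + 1) = base A j := by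
        unfold base
        congr 1
        apply Nat.log_eq_of_pow_le_of_lt_pow
        · exact hle.trans (Nat.le_succ j)
        · rwa [pow_succ, mul_comm]
      rw [hb]
      by_cases hc : IsCopy A k ℓ j
      · rw [cnt_succ_of_copy hc]
        push_cast
        refine ⟨by linarith, ?_⟩
        have h3 := hc.2.2
        have h4 : (j : ℝ) + 1 ≤ base A j + copyLen k ℓ (base A j) := by exact_mod_cast h3
        have h5 : (copyLen k ℓ (base A j) : ℝ) ≤ κ * base A j + 1 := by
          unfold copyLen
          push_cast
          have := Nat.cast_div_le (α := ℝ) (m := base A j * k) (n := ℓ)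
          push_cast at this
          rw [hκ']
          calc _ ≤ (base A j : ℝ) * k / ℓ + 1 := by linarith
            _ = _ := by ring
        linarith
      · rw [cnt_succ_of_not_copy hc]
        push_cast
        constructor <;> linarith
    · have hb : base A (j + 1) = A * base A j := by
        unfold base
        rw [mul_comm, ← pow_succ]
        congr 1
        apply Nat.log_eq_of_pow_le_of_lt_pow
        · rw [pow_succ, mul_comm]; exact hcase
        · have : j + 1 = A * base A j := by omega
          rw [this, pow_succ, pow_succ, mul_comm]
          unfold base at hp1 ⊢
          exact lt_mul_of_one_lt_right (Nat.mul_pos hp1 (by omega)) (by omega)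
      have hjj : j + 1 = A * base A j := by omega
      have hcm : (cnt A k ℓ j : ℝ) ≤ cnt A k ℓ (j + 1) := by
        rw [cnt]; push_cast
        split_ifs <;> simp
      have hjr : ((j + 1 : ℕ) : ℝ) = A * base A j := by rw [hjj]; push_cast; ring
      rw [hb]
      have hmain : ((j + 1 : ℕ) : ℝ) - cnt A k ℓ (j + 1) ≤ η * (A * base A j) := by
        have e1 : η * (A - 1) = κ + 2 := by
          rw [hη]; apply div_mul_cancel₀; linarith
        have : η * (A * base A j) = η * base A j + (κ + 2) * base A j := by
          rw [← e1]; ring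
        rw [this]
        push_cast
        nlinarith
      push_cast at hmain hjr ⊢
      constructor
      · linarith
      · have : 0 ≤ κ * (A * base A j) := by positivity
        linarith

theorem cnt_lower {A k ℓ : ℕ} (hA : 2 ≤ A) {κ η : ℝ} (hκ : 0 ≤ κ)
    (hκ' : κ = (k : ℝ) / ℓ) (hη : η = (κ + 2) / ((A : ℝ) - 1)) (j : ℕ) :
    (1 / (1 + κ) - η) * j - 1 ≤ cnt A k ℓ j := by
  rcases Nat.eq_zero_or_pos j with h0 | h0
  · subst h0
    simp [cnt]
  obtain ⟨h1, h2⟩ := cnt_claim (k := k) (ℓ := ℓ) hA hκ hκ' hη j h0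
  have hA' : (2 : ℝ) ≤ A := by exact_mod_cast hA
  have hη0 : 0 ≤ η := by rw [hη]; exact div_nonneg (by linarith) (by linarith)
  have hle : (base A j : ℝ) ≤ j := by exact_mod_cast Nat.pow_log_le_self A (by omega)
  have h3 : η * base A j ≤ η * j := mul_le_mul_of_nonneg_left hle hη0
  have hk1 : 0 < 1 + κ := by linarith
  have h4 : ((j : ℝ) - cnt A k ℓ j - η * j) * (1 + κ) ≤ κ * j + 1 := by
    have a1 : (j : ℝ) - cnt A k ℓ j - η * j ≤ j - base A j := by linarith
    have a2 : (j : ℝ) - cnt A k ℓ j - η * j ≤ κ * base A j + 1 := by linarith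
    nlinarith [mul_le_mul_of_nonneg_left a1 hκ]
  have h5 : (1 / (1 + κ)) * (1 + κ) = 1 := by field_simp
  by_contra hcon
  push Not at hcon
  have h6 := mul_lt_mul_of_pos_right hcon hk1
  have h7 : ((1 / (1 + κ) - η) * j - 1) * (1 + κ) = j - η * j * (1 + κ) - (1 + κ) := by
    calc _ = (1 / (1 + κ)) * (1 + κ) * j - η * j * (1 + κ) - (1 + κ) := by ring
      _ = _ := by rw [h5]; ring
  rw [h7] at h6
  linarith

section
variable {S : Set ℕ} {f : SeqSpace (Fin 2) → ℝ} {ℓ k M : ℕ} {V : Fin M → ℕ → Fin 2}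

/-- Concatenation of blocks. -/
def concat (ℓ : ℕ) (V : Fin M → ℕ → Fin 2) (y : ℕ → Fin M) : SeqSpace (Fin 2) :=
  fun n => V (y (n / ℓ)) (n % ℓ)

theorem concat_apply (y : ℕ → Fin M) (j i : ℕ) (hi : i < ℓ) :
    concat ℓ V y (ℓ * j + i) = V (y j) i := by
  unfold concat
  rw [Nat.mul_add_div (by omega), Nat.div_eq_of_lt hi, add_zero, Nat.mul_add_mod,
    Nat.mod_eq_of_lt hi]

theorem concat_mem (hV : IsBlockFamily S f ℓ k M V) (hℓ : 0 < ℓ) (y : ℕ → Fin M) :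
    concat ℓ V y ∈ sGapShift S := by
  intro i j hij hi hj hz
  obtain ⟨x, hx, hx0, hxl, hxV⟩ := hV.2.1 (y (j / ℓ))
  set b := j / ℓ with hb
  have hjb : ℓ * b + j % ℓ = j := Nat.div_add_mod j ℓ
  have hjm : j % ℓ < ℓ := Nat.mod_lt _ hℓ
  -- values of the concatenation inside block `b`
  have hval : ∀ u < ℓ, concat ℓ V y (ℓ * b + u) = x (u + 1) := by
    intro u hu
    rw [concat_apply y b u hu]
    exact hxV u hu
  -- the symbol just before block `b`
  have hlast : 0 < b → concat ℓ V y (ℓ * b - 1) = 1 := by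
    intro hb0
    obtain ⟨x', _, _, hxl', hxV'⟩ := hV.2.1 (y (b - 1))
    obtain ⟨c, hc⟩ : ∃ c, b = c + 1 := ⟨b - 1, by omega⟩
    have : ℓ * b - 1 = ℓ * c + (ℓ - 1) := by rw [hc, mul_add, mul_one]; omega
    rw [this, concat_apply y c (ℓ - 1) (by omega)]
    rw [show b - 1 = c by omega] at hxV'
    rw [hxV' (ℓ - 1) (by omega), show ℓ - 1 + 1 = ℓ by omega, hxl']
  have hib : ℓ * b ≤ i + 1 := by
    by_contra hlt
    push Not at hlt
    have hb0 : 0 < b := by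
      rcases Nat.eq_zero_or_pos b with h | h
      · rw [h] at hlt; simp at hlt
      · exact h
    have h1 := hlast hb0
    have h2 := hz (ℓ * b - 1) (by omega) (by omega)
    rw [h1] at h2
    exact absurd h2 (by decide)
  obtain ⟨i', hi'⟩ := Nat.exists_eq_add_of_le hib
  have hxi : x i' = 1 := by
    rcases Nat.eq_zero_or_pos i' with h | h
    · rw [h]; exact hx0
    · have := hval (i' - 1) (by omega)
      rw [show ℓ * b + (i' - 1) = i by omega, hi, show i' - 1 + 1 = i' by omega] at this
      exact this.symm
  have hxj : x (j % ℓ + 1) = 1 := by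
    rw [← hval _ hjm, hjb]; exact hj
  have := hx i' (j % ℓ + 1) (by omega) hxi hxj (fun u h1 h2 => by
    have h3 := hval (u - 1) (by omega)
    rw [show u - 1 + 1 = u by omega] at h3
    rw [← h3]
    exact hz _ (by omega) (by omega))
  rwa [show j % ℓ + 1 - i' - 1 = j - i - 1 by omega] at this

theorem birkhoff_concat (hV : IsBlockFamily S f ℓ k M V) (hℓ : 0 < ℓ) (y : ℕ → Fin M) (p : ℕ) :
    birkhoff f (ℓ * p) (concat ℓ V y) ≤ p * k := by
  induction p with
  | zero => simp [birkhoff]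
  | succ p ih =>
    rw [mul_add, mul_one, birkhoff_add]
    have := hV.2.2 (y p) _ (shift_iterate_mem (concat_mem hV hℓ y) (ℓ * p)) (fun i hi => by
      rw [shift_iterate_apply, concat_apply y p i hi])
    push_cast
    linarith

theorem concat_mem_recSetF (hV : IsBlockFamily S f ℓ k M V) (hℓ : 0 < ℓ) {A : ℕ}
    (hA : k + 2 ≤ A) (ω : ℕ → Fin M) :
    concat ℓ V (yseq A k ℓ ω) ∈ recSetF (sGapShift S) f := by
  refine ⟨concat_mem hV hℓ _, ?_⟩
  rw [frequently_atTop]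
  intro n
  have hlt : n < A ^ n := Nat.lt_pow_self (by omega)
  refine ⟨ℓ * A ^ n, by nlinarith, ?_⟩
  have h1 : dist (shift^[ℓ * A ^ n] (concat ℓ V (yseq A k ℓ ω))) (concat ℓ V (yseq A k ℓ ω)) ≤
      Real.exp (-((ℓ * copyLen k ℓ (A ^ n) : ℕ) : ℝ)) := by
    apply dist_le_of_agree
    intro u hu
    rw [shift_iterate_apply]
    have hdm := Nat.div_add_mod u ℓ
    have hm := Nat.mod_lt u hℓ
    have hq : u / ℓ < copyLen k ℓ (A ^ n) := by
      rw [Nat.div_lt_iff_lt_mul hℓ, mul_comm]; exact hu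
    have e1 : ℓ * A ^ n + u = ℓ * (A ^ n + u / ℓ) + u % ℓ := by
      rw [mul_add]; omega
    rw [e1, concat_apply _ _ _ hm, yseq_copy hA ω n _ hq]
    rfl
  refine h1.trans ?_
  rw [Real.exp_le_exp]
  have h2 := birkhoff_concat hV hℓ (yseq A k ℓ ω) (A ^ n)
  have h3 : A ^ n * k ≤ ℓ * copyLen k ℓ (A ^ n) := by
    unfold copyLen
    exact (Nat.lt_mul_div_succ _ hℓ).le
  have h4 : ((A ^ n * k : ℕ) : ℝ) ≤ ((ℓ * copyLen k ℓ (A ^ n) : ℕ) : ℝ) := by exact_mod_cast h3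
  push_cast at h2 h4 ⊢
  linarith

theorem concat_decode (hV : IsBlockFamily S f ℓ k M V) {y y' : ℕ → Fin M} {n : ℕ}
    (h : ∀ i < ℓ * n, concat ℓ V y i = concat ℓ V y' i) : ∀ j < n, y j = y' j := by
  intro j hj
  by_contra hne
  obtain ⟨i, hi, hVi⟩ := hV.1 _ _ hne
  apply hVi
  have hlt : ℓ * j + i < ℓ * n := by nlinarith
  have := h _ hlt
  rwa [concat_apply _ _ _ hi, concat_apply _ _ _ hi] at this

theorem le_dimH_of_blocks (hV : IsBlockFamily S f ℓ k M V) (hℓ : 0 < ℓ) (hM : 2 ≤ M)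
    {t r : ℝ} (hr : 0 < r) (hrt : r < t) (hMt : Real.exp (t * (ℓ + k)) ≤ M) :
    ENNReal.ofReal r ≤ dimH (recSetF (sGapShift S) f) := by
  have hℓ' : (0 : ℝ) < ℓ := by exact_mod_cast hℓ
  have ht : 0 < t := hr.trans hrt
  set κ : ℝ := (k : ℝ) / ℓ with hκ'
  have hκ : 0 ≤ κ := by positivity
  have hκℓ : (ℓ : ℝ) * (1 + κ) = ℓ + k := by rw [hκ']; field_simp
  -- choose the base
  obtain ⟨A, hA1, hA2⟩ : ∃ A : ℕ, k + 2 ≤ A ∧ (κ + 2) * (t * (1 + κ)) / (t - r) ≤ (A : ℝ) - 1 := by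
    obtain ⟨B, hB⟩ := exists_nat_ge ((κ + 2) * (t * (1 + κ)) / (t - r))
    refine ⟨B + k + 2, by omega, ?_⟩
    push_cast
    have : (0 : ℝ) ≤ k := Nat.cast_nonneg _
    linarith
  have hA' : (2 : ℝ) ≤ A := by exact_mod_cast (by omega : 2 ≤ A)
  set η : ℝ := (κ + 2) / ((A : ℝ) - 1) with hη
  have hη0 : 0 ≤ η := div_nonneg (by linarith) (by linarith)
  have hηle : η * (t * (1 + κ)) ≤ t - r := by
    rw [div_le_iff₀ (by linarith)] at hA2
    rw [hη, div_mul_eq_mul_div, div_le_iff₀ (by linarith)]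
    linarith
  set θ : ℝ := 1 / (1 + κ) - η with hθ
  have hθr : r ≤ θ * (t * (1 + κ)) := by
    have : θ * (t * (1 + κ)) = t - η * (t * (1 + κ)) := by rw [hθ]; field_simp
    rw [this]; linarith
  have hθ0 : 0 < θ := by
    by_contra hcon
    push Not at hcon
    have : θ * (t * (1 + κ)) ≤ 0 := mul_nonpos_of_nonpos_of_nonneg hcon (by positivity)
    linarith
  have hcnt : ∀ j : ℕ, θ * j - 1 ≤ cnt A k ℓ j := cnt_lower (by omega) hκ hκ' hη
  let Φ : (ℕ → Fin M) → SeqSpace (Fin 2) := fun ω => concat ℓ V (yseq A k ℓ ω)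
  have hdec : ∀ ω ω' : ℕ → Fin M, ∀ n, (∀ i < ℓ * n, Φ ω i = Φ ω' i) →
      ∀ i < cnt A k ℓ n, ω i = ω' i := fun ω ω' n h =>
    digits_eq_of_yseq_eq (concat_decode hV h)
  have hΦinj : Function.Injective Φ := by
    intro ω ω' h
    funext i
    obtain ⟨n, hn⟩ := exists_nat_gt (((i : ℝ) + 1) / θ)
    rw [div_lt_iff₀ hθ0] at hn
    have h1 := hcnt n
    have h2 : (i : ℝ) < cnt A k ℓ n := by linarith
    exact hdec ω ω' n (fun u _ => by rw [h]) i (by exact_mod_cast h2)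
  haveI : Nonempty (ℕ → Fin M) := ⟨fun _ => ⟨0, by omega⟩⟩
  let π : SeqSpace (Fin 2) → ℝ := fun x => Real.ofDigits (Function.invFun Φ x)
  have hπ : ∀ ω, π (Φ ω) = Real.ofDigits ω := fun ω => by
    simp only [π, Function.leftInverse_invFun hΦinj ω]
  set c : ℝ := t * (ℓ * (1 + κ)) * (θ + 1) with hc
  have hlogM : t * (ℓ * (1 + κ)) ≤ Real.log M := by
    rw [hκℓ, Real.le_log_iff_exp_le (by positivity)]
    exact hMt
  have hbound : ∀ ω ω', Φ ω ≠ Φ ω' →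
      |π (Φ ω) - π (Φ ω')| ≤ Real.exp c * dist (Φ ω) (Φ ω') ^ r := by
    intro ω ω' hne
    rw [hπ, hπ, dist_eq_exp hne, ← Real.exp_mul, ← Real.exp_add]
    set q := lcp (Φ ω) (Φ ω') with hq
    have h1 := Real.abs_ofDigits_sub_ofDigits_le (hdec ω ω' (q / ℓ) (fun i hi =>
      eq_of_lt_lcp (lt_of_lt_of_le hi (Nat.mul_div_le q ℓ))))
    refine h1.trans ?_
    have hM0 : (0 : ℝ) < M := by positivity
    rw [← Real.exp_log hM0, ← Real.exp_nat_mul, ← Real.exp_neg, Real.exp_le_exp]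
    have h2 := hcnt (q / ℓ)
    have h3 : (q : ℝ) ≤ ℓ * ((q / ℓ : ℕ) : ℝ) + ℓ := by
      have e1 := Nat.div_add_mod q ℓ
      have e2 := Nat.mod_lt q hℓ
      exact_mod_cast (by omega : q ≤ ℓ * (q / ℓ) + ℓ)
    have h4 : (cnt A k ℓ (q / ℓ) : ℝ) * (t * (ℓ * (1 + κ))) ≤
        cnt A k ℓ (q / ℓ) * Real.log M := mul_le_mul_of_nonneg_left hlogM (Nat.cast_nonneg _)
    have h5 : (θ * ((q / ℓ : ℕ) : ℝ) - 1) * (t * (ℓ * (1 + κ))) ≤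
        cnt A k ℓ (q / ℓ) * (t * (ℓ * (1 + κ))) :=
      mul_le_mul_of_nonneg_right h2 (by positivity)
    have h6 : θ * (t * (1 + κ)) * q ≤ θ * (t * (1 + κ)) * (ℓ * ((q / ℓ : ℕ) : ℝ) + ℓ) :=
      mul_le_mul_of_nonneg_left h3 (by positivity)
    have h7 : r * q ≤ θ * (t * (1 + κ)) * q :=
      mul_le_mul_of_nonneg_right hθr (Nat.cast_nonneg _)
    rw [hc]
    linarith
  have hHolder : HolderOnWith (Real.toNNReal (Real.exp c)) (Real.toNNReal r) π (range Φ) := by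
    rintro _ ⟨ω, rfl⟩ _ ⟨ω', rfl⟩
    by_cases hne : Φ ω = Φ ω'
    · rw [hne]; simp
    rw [Real.coe_toNNReal _ hr.le, edist_dist, edist_dist, Real.dist_eq,
      ENNReal.ofReal_rpow_of_pos (dist_pos.mpr hne)]
    change _ ≤ ENNReal.ofReal (Real.exp c) * _
    rw [← ENNReal.ofReal_mul (Real.exp_pos _).le]
    exact ENNReal.ofReal_le_ofReal (hbound ω ω' hne)
  have hdim := hHolder.dimH_image_le (Real.toNNReal_pos.mpr hr)
  have hsub : Icc (0 : ℝ) 1 ⊆ π '' range Φ := by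
    intro a ha
    obtain ⟨ω, _, hω⟩ := Real.ofDigits_SurjOn (b := M) (by omega) ha
    exact ⟨Φ ω, ⟨ω, rfl⟩, by rw [hπ, hω]⟩
  have hone : (1 : ℝ≥0∞) ≤ dimH (π '' range Φ) := by
    have h1 : dimH (Icc (0 : ℝ) 1) = 1 := by
      rw [Real.dimH_of_mem_nhds (x := (1 / 2 : ℝ)) (Icc_mem_nhds (by norm_num) (by norm_num))]
      simp
    rw [← h1]
    exact dimH_mono hsub
  have hE : range Φ ⊆ recSetF (sGapShift S) f := by
    rintro _ ⟨ω, rfl⟩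
    exact concat_mem_recSetF hV hℓ hA1 ω
  refine le_trans ?_ (dimH_mono hE)
  have h1 := hone.trans hdim
  rw [ENNReal.le_div_iff_mul_le (Or.inl (by simpa using hr)) (Or.inl ENNReal.coe_ne_top),
    one_mul] at h1
  exact h1

end

theorem dimH_recSetF_sGapShift
    (S : Set ℕ) (hS : S.Infinite)
    (f : SeqSpace (Fin 2) → ℝ) (hfc : ContinuousOn f (sGapShift S))
    (hfpos : ∀ x ∈ sGapShift S, 0 < f x) :
    (∃! s : ℝ, 0 ≤ s ∧
      pressure (sGapShift S) (language (sGapShift S))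
        (fun x => -(s * (f x + 1))) = 0) ∧
    ∀ s : ℝ, 0 ≤ s →
      pressure (sGapShift S) (language (sGapShift S))
        (fun x => -(s * (f x + 1))) = 0 →
      dimH (recSetF (sGapShift S) f) = ENNReal.ofReal s := by
  obtain ⟨F, hF0, hF⟩ := exists_bound hfc
  have hpe : ∀ s, pressure (sGapShift S) (language (sGapShift S))
      (fun x => -(s * (f x + 1))) = pr S f s := fun s => pressure_eq S f s
  simp only [hpe]
  refine ⟨existsUnique_pr hfpos hF0 hF, ?_⟩
  intro s hs hs0
  apply le_antisymm
  · have hlim : Tendsto (fun t => ENNReal.ofReal t) (nhdsWithin s (Ioi s))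
        (nhds (ENNReal.ofReal s)) :=
      (ENNReal.continuous_ofReal.tendsto s).mono_left nhdsWithin_le_nhds
    refine ge_of_tendsto hlim ?_
    filter_upwards [self_mem_nhdsWithin] with t ht
    have ht' : s < t := ht
    apply dimH_le_of_pr_neg hfpos (by linarith)
    have := pr_strictAnti hfpos hF hs ht'
    linarith
  · rcases hs.eq_or_lt with h0 | h0
    · rw [← h0]; simp
    have hlim : Tendsto (fun t => ENNReal.ofReal t) (nhdsWithin s (Iio s))
        (nhds (ENNReal.ofReal s)) :=
      (ENNReal.continuous_ofReal.tendsto s).mono_left nhdsWithin_le_nhds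
    refine le_of_tendsto hlim ?_
    filter_upwards [Ioo_mem_nhdsLT h0] with r hr
    obtain ⟨t, hrt, hts⟩ := exists_between hr.2
    have ht : 0 < t := hr.1.trans hrt
    have hpr : 0 < pr S f t := by
      have := pr_strictAnti hfpos hF ht.le hts
      linarith
    obtain ⟨ℓ, k, M, hℓ, hM, hMt, V, hV⟩ := exists_blocks hfc hfpos ht hpr
    exact le_dimH_of_blocks hV hℓ hM hr.1 hrt hMt
end
end

section
/- Let (X,d) be a compact metric space, T : X → X a Borel measurable map, and μ a T-invariant Borel probability measure on X. Assume that for some α > 0 the α-dimensional Hausdorff measure H^α of X is σ-finite. Then for μ-almost every x ∈ X, liminf_{n→∞} n^{1/α} d(T^n x, x) < ∞. If moreover H^α(X) = 0, then for μ-almost every x ∈ X, liminf_{n→∞} n^{1/α} d(T^n x, x) = 0. -/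
open Filter MeasureTheory Set
open scoped ENNReal NNReal

lemma bosh_aux1
    {X : Type*} [MetricSpace X] [CompactSpace X] [MeasurableSpace X] [BorelSpace X]
    (T : X → X) (μ : Measure X) [IsProbabilityMeasure μ] (hT : MeasurePreserving T μ μ)
    (α : ℝ) (hα : 0 < α) (M δ : ℝ) (hM : 0 < M) (hδ : 0 < δ) (A : Set X) (hA : MeasurableSet A)
    (h : ∀ x ∈ A, ∀ n : ℕ, 1 ≤ n → dist (T^[n] x) x ≤ δ →
      M ≤ (n : ℝ) ^ (1 / α) * dist (T^[n] x) x) :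
    ENNReal.ofReal (M ^ α) • μ.restrict A ≤ μH[α] := by
  refine Measure.le_hausdorffMeasure α _ (ENNReal.ofReal δ) (by simpa using hδ) ?_
  intro s hs
  rw [← Metric.ediam_closure] at hs ⊢
  refine (measure_mono subset_closure).trans ?_
  have hcl : MeasurableSet (closure s) := isClosed_closure.measurableSet
  set V := closure s with hV
  rw [Measure.smul_apply, Measure.restrict_apply hcl, smul_eq_mul]
  set U := V ∩ A with hU
  have hUm : MeasurableSet U := hcl.inter hA
  have hfin : Metric.ediam V ≠ ⊤ := ne_top_of_le_ne_top ENNReal.ofReal_ne_top hs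
  obtain ⟨r, hr0, hr⟩ : ∃ r : ℝ, 0 ≤ r ∧ Metric.ediam V = ENNReal.ofReal r :=
    ⟨_, ENNReal.toReal_nonneg, (ENNReal.ofReal_toReal hfin).symm⟩
  obtain ⟨m, hm0, hm⟩ : ∃ m : ℝ, 0 ≤ m ∧ μ U = ENNReal.ofReal m :=
    ⟨_, ENNReal.toReal_nonneg, (ENNReal.ofReal_toReal (measure_ne_top μ U)).symm⟩
  have hrδ : r ≤ δ := by
    rw [hr] at hs
    exact (ENNReal.ofReal_le_ofReal_iff hδ.le).1 hs
  have hMα : 0 < M ^ α := Real.rpow_pos_of_pos hM α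
  rw [hr, hm, ENNReal.ofReal_rpow_of_nonneg hr0 hα.le, ← ENNReal.ofReal_mul hMα.le]
  apply ENNReal.ofReal_le_ofReal
  by_contra! hlt
  have hrα : 0 ≤ r ^ α := Real.rpow_nonneg hr0 α
  have hmpos : 0 < m := by
    rcases hm0.eq_or_lt with h0 | h0
    · rw [← h0] at hlt; linarith
    · exact h0
  have hvol : μ univ < ((⌊1 / m⌋₊ + 1 : ℕ) : ℝ≥0∞) * μ U := by
    rw [measure_univ, hm, ← ENNReal.ofReal_natCast, ← ENNReal.ofReal_mul (by positivity),
      ← ENNReal.ofReal_one]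
    apply (ENNReal.ofReal_lt_ofReal_iff_of_nonneg zero_le_one).2
    have := Nat.lt_floor_add_one (1 / m)
    rw [div_lt_iff₀ hmpos] at this
    push_cast
    exact this
  obtain ⟨x, hx, n, hn, hnx⟩ :=
    hT.exists_mem_iterate_mem_of_measure_univ_lt_mul_measure hUm.nullMeasurableSet hvol
  have hd : dist (T^[n] x) x ≤ r := by
    have := Metric.edist_le_ediam_of_mem hnx.1 hx.1
    rw [hr, edist_dist] at this
    exact (ENNReal.ofReal_le_ofReal_iff hr0).1 this
  have h1 := h x hx.2 n hn.1 (hd.trans hrδ)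
  have hn1 : (n : ℝ) ≤ 1 / m :=
    (Nat.cast_le.2 (Nat.lt_succ_iff.1 hn.2)).trans (Nat.floor_le (by positivity))
  have h2 : M ≤ (n : ℝ) ^ (1 / α) * r := h1.trans (by gcongr)
  have h3 : M ^ α ≤ n * r ^ α := by
    calc M ^ α ≤ ((n : ℝ) ^ (1 / α) * r) ^ α := Real.rpow_le_rpow hM.le h2 hα.le
      _ = n * r ^ α := by
        rw [Real.mul_rpow (by positivity) hr0, ← Real.rpow_mul (by positivity),
          one_div_mul_cancel hα.ne', Real.rpow_one]
  have h4 : M ^ α * m ≤ r ^ α := by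
    calc M ^ α * m ≤ (1 / m * r ^ α) * m := by
          gcongr
          exact h3.trans (by gcongr)
      _ = r ^ α := by field_simp
  linarith

lemma bosh_aux2
    {X : Type*} [MetricSpace X] [CompactSpace X] [MeasurableSpace X] [BorelSpace X]
    (T : X → X) (μ : Measure X) [IsProbabilityMeasure μ] (hT : MeasurePreserving T μ μ)
    (α : ℝ) (hα : 0 < α) (M : ℝ) (hM : 0 < M) (Y : Set X) :
    ENNReal.ofReal (M ^ α) * μ ({x | ENNReal.ofReal M < atTop.liminf
        (fun n : ℕ => ENNReal.ofReal ((n : ℝ) ^ (1 / α) * dist (T^[n] x) x))} ∩ Y)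
      ≤ (μH[α] : Measure X) Y := by
  set B : ℕ → Set X := fun j => {x | ∀ n : ℕ, 1 ≤ n → dist (T^[n] x) x ≤ 1 / ((j : ℝ) + 1) →
      M ≤ (n : ℝ) ^ (1 / α) * dist (T^[n] x) x} with hB
  have hBm : ∀ j, MeasurableSet (B j) := by
    intro j
    have hd : ∀ n : ℕ, Measurable fun x => dist (T^[n] x) x := fun n =>
      (hT.measurable.iterate n).dist measurable_id
    have : B j = ⋂ n : ℕ, ⋂ (_ : 1 ≤ n), ({x | dist (T^[n] x) x ≤ 1 / ((j : ℝ) + 1)}ᶜ ∪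
        {x | M ≤ (n : ℝ) ^ (1 / α) * dist (T^[n] x) x}) := by
      ext x
      simp only [hB, mem_ofPred_eq, mem_iInter, mem_union, mem_compl_iff, imp_iff_not_or]
    rw [this]
    refine MeasurableSet.iInter fun n => MeasurableSet.iInter fun _ => ?_
    exact (measurableSet_le (hd n) measurable_const).compl.union
      (measurableSet_le measurable_const ((hd n).const_mul _))
  have hmono : Monotone fun j => Y ∩ B j := by
    intro i j hij x hx
    refine ⟨hx.1, fun n hn hd => hx.2 n hn (hd.trans ?_)⟩
    gcongr
  have hsub : ({x | ENNReal.ofReal M < atTop.liminf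
        (fun n : ℕ => ENNReal.ofReal ((n : ℝ) ^ (1 / α) * dist (T^[n] x) x))} ∩ Y)
        ⊆ ⋃ j, Y ∩ B j := by
    rintro x ⟨hx, hxY⟩
    rw [mem_ofPred_eq] at hx
    have hev := eventually_lt_of_lt_liminf hx
    obtain ⟨N, hN⟩ := eventually_atTop.1 hev
    have hN' : ∀ n ≥ N, M < (n : ℝ) ^ (1 / α) * dist (T^[n] x) x := fun n hn =>
      (ENNReal.ofReal_lt_ofReal_iff_of_nonneg hM.le).1 (hN n hn)
    have hpos : ∀ n : ℕ, 1 ≤ n → 0 < dist (T^[n] x) x := by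
      intro n hn
      rw [dist_pos]
      intro heq
      have h1 := hN' (n * N) (Nat.le_mul_of_pos_left N hn)
      have h2 : T^[n * N] x = x := by
        rw [Function.iterate_mul]
        exact Function.iterate_fixed heq N
      rw [h2, dist_self, mul_zero] at h1
      linarith
    have hj : ∀ᶠ j : ℕ in atTop, ∀ n ∈ Finset.Ico 1 N, 1 / ((j : ℝ) + 1) < dist (T^[n] x) x := by
      rw [Filter.eventually_all_finset]
      intro n hn
      exact tendsto_one_div_add_atTop_nhds_zero_nat.eventually_lt_const
        (hpos n (Finset.mem_Ico.1 hn).1)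
    obtain ⟨j, hj⟩ := hj.exists
    refine mem_iUnion.2 ⟨j, hxY, fun n hn hd => ?_⟩
    by_cases hnN : N ≤ n
    · exact (hN' n hnN).le
    · exact absurd (hj n (Finset.mem_Ico.2 ⟨hn, not_le.1 hnN⟩)) (not_lt.2 hd)
  refine (mul_le_mul_right (measure_mono hsub) _).trans ?_
  rw [hmono.measure_iUnion, ENNReal.mul_iSup]
  refine iSup_le fun j => ?_
  have := bosh_aux1 T μ hT α hα M (1 / ((j : ℝ) + 1)) hM (by positivity) (B j) (hBm j)
    (fun x hx => hx) Y
  rwa [Measure.smul_apply, Measure.restrict_apply' (hBm j), smul_eq_mul] at this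


/-- **Boshernitzan's theorem.** Let `(X,d)` be a compact metric space, `T : X → X` Borel
measurable and `μ` a `T`-invariant Borel probability measure. If the `α`-dimensional
Hausdorff measure of `X` is σ-finite for some `α > 0`, then for `μ`-a.e. `x`,
`liminf_n n^{1/α} d(T^n x, x) < ∞`; if moreover `H^α(X) = 0`, then for `μ`-a.e. `x`
this liminf is `0`. -/
theorem boshernitzan_quantitative_recurrence
    {X : Type*} [MetricSpace X] [CompactSpace X] [MeasurableSpace X] [BorelSpace X]
    (T : X → X) (hT : Measurable T)
    (μ : Measure X) [IsProbabilityMeasure μ]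
    (hinv : ∀ E : Set X, MeasurableSet E → μ (T ⁻¹' E) = μ E)
    (α : ℝ) (hα : 0 < α)
    (hσ : SigmaFinite (μH[α] : Measure X)) :
    (∀ᵐ x ∂μ, atTop.liminf
        (fun n : ℕ => ENNReal.ofReal ((n : ℝ) ^ (1 / α) * dist (T^[n] x) x)) < ⊤) ∧
    ((μH[α] : Measure X) Set.univ = 0 →
      ∀ᵐ x ∂μ, atTop.liminf
        (fun n : ℕ => ENNReal.ofReal ((n : ℝ) ^ (1 / α) * dist (T^[n] x) x)) = 0) := by
  have hmp : MeasurePreserving T μ μ := by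
    refine ⟨hT, Measure.ext fun E hE => ?_⟩
    rw [Measure.map_apply hT hE, hinv E hE]
  constructor
  · rw [ae_iff]
    set Z := {x | ¬ atTop.liminf
        (fun n : ℕ => ENNReal.ofReal ((n : ℝ) ^ (1 / α) * dist (T^[n] x) x)) < ⊤} with hZ
    have hY : ∀ i, μ (Z ∩ spanningSets (μH[α] : Measure X) i) = 0 := by
      intro i
      by_contra hne
      obtain ⟨k, hk⟩ := ENNReal.exists_nat_mul_gt hne
        (measure_spanningSets_lt_top (μH[α] : Measure X) i).ne
      have hk0 : 0 < (k : ℝ) := by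
        rcases Nat.eq_zero_or_pos k with h0 | h0
        · simp [h0] at hk
        · exact_mod_cast h0
      have h1 := bosh_aux2 T μ hmp α hα ((k : ℝ) ^ (1 / α)) (by positivity)
        (spanningSets (μH[α] : Measure X) i)
      rw [← Real.rpow_mul hk0.le, one_div_mul_cancel hα.ne', Real.rpow_one,
        ENNReal.ofReal_natCast] at h1
      refine absurd (hk.trans_le ((mul_le_mul_right (measure_mono ?_) _).trans h1)) (lt_irrefl _)
      refine inter_subset_inter_left _ fun x hx => ?_
      have hx' := not_lt_top_iff.1 hx
      rw [mem_ofPred_eq, hx']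
      exact ENNReal.ofReal_lt_top
    have : Z = ⋃ i, Z ∩ spanningSets (μH[α] : Measure X) i := by
      rw [← inter_iUnion, iUnion_spanningSets, inter_univ]
    rw [this]
    exact measure_iUnion_null hY
  · intro h0
    have key : ∀ k : ℕ, ∀ᵐ x ∂μ, atTop.liminf
        (fun n : ℕ => ENNReal.ofReal ((n : ℝ) ^ (1 / α) * dist (T^[n] x) x))
          ≤ ENNReal.ofReal (1 / ((k : ℝ) + 1)) := by
      intro k
      have hp : 0 < 1 / ((k : ℝ) + 1) := by positivity
      have h1 := bosh_aux2 T μ hmp α hα (1 / ((k : ℝ) + 1)) hp univ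
      rw [h0, nonpos_iff_eq_zero, mul_eq_zero, inter_univ] at h1
      rw [ae_iff]
      simp only [not_le]
      refine h1.resolve_left ?_
      rw [ENNReal.ofReal_eq_zero, not_le]
      exact Real.rpow_pos_of_pos hp α
    filter_upwards [ae_all_iff.2 key] with x hx
    have ht : Tendsto (fun k : ℕ => ENNReal.ofReal (1 / ((k : ℝ) + 1))) atTop (nhds 0) := by
      rw [← ENNReal.ofReal_zero]
      exact ENNReal.tendsto_ofReal tendsto_one_div_add_atTop_nhds_zero_nat
    exact nonpos_iff_eq_zero.1 (ge_of_tendsto' ht hx)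
end
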